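/- arXiv:0810.2117 — 3 statements merged into one kernel-verified Lean document; each statement's English description precedes it below -/
import Mathlib

section
/- (Glueing theorem.) Let d, k ≥ 0, let m_1,...,m_r, ℓ_1, ℓ_2, s_1, s_2 be non-negative integers. Suppose the system L_3(k; ℓ_1^{×s_1}, ℓ_2^{×s_2}) is non-special. Set L_1 = L_3(d; m_1,...,m_r, ℓ_1^{×s_1}, ℓ_2^{×s_2}) and L_2 = L_3(d; m_1,...,m_r, k+1). If either −1 ≤ vdim L_2 ≤ vdim L_1 or vdim L_1 ≤ vdim L_2 ≤ −1, then non-specialty of L_2 implies non-specialty of L_1. -/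
open MvPolynomial

/-- The differential operator `∂₀^{ν 0} ∂₁^{ν 1} ∂₂^{ν 2} ∂₃^{ν 3}` on polynomials
in 4 variables over `ℚ`. -/
noncomputable def diffOp (ν : Fin 4 → ℕ) :
    Module.End ℚ (MvPolynomial (Fin 4) ℚ) :=
  ((pderiv (0 : Fin 4)).toLinearMap ^ ν 0) * ((pderiv (1 : Fin 4)).toLinearMap ^ ν 1) *
    ((pderiv (2 : Fin 4)).toLinearMap ^ ν 2) * ((pderiv (3 : Fin 4)).toLinearMap ^ ν 3)

/-- Polynomials all of whose partial derivatives of order `< m` (including order 0)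
vanish at the point `pt : ℚ⁴`. -/
noncomputable def vanishingSpace (m : ℕ) (pt : Fin 4 → ℚ) :
    Submodule ℚ (MvPolynomial (Fin 4) ℚ) :=
  ⨅ (ν : Fin 4 → ℕ) (_ : ∑ j, ν j < m),
    LinearMap.ker ((aeval pt).toLinearMap ∘ₗ
      (diffOp ν : MvPolynomial (Fin 4) ℚ →ₗ[ℚ] MvPolynomial (Fin 4) ℚ))

/-- `V(d; m_1,…,m_r; p_1,…,p_r)`: homogeneous polynomials of degree `d` in 4 variables
over `ℚ` vanishing to order `≥ ms[i]` at `pts i` for each `i`. -/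
noncomputable def systemSpace (d : ℕ) (ms : List ℕ) (pts : Fin ms.length → Fin 4 → ℚ) :
    Submodule ℚ (MvPolynomial (Fin 4) ℚ) :=
  homogeneousSubmodule (Fin 4) ℚ d ⊓ ⨅ i, vanishingSpace (ms.get i) (pts i)

/-- The virtual dimension `vdim L_3(d; m_1,…,m_r) = C(d+3,3) − Σ C(m_i+2,3) − 1`. -/
def vdim (d : ℕ) (ms : List ℕ) : ℤ :=
  ((d + 3).choose 3 : ℤ) - (ms.map fun m => ((m + 2).choose 3 : ℤ)).sum - 1

/-- The linear system `L_3(d; m_1,…,m_r)` is non-special: there exist pairwise linearly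
independent points of `ℚ⁴ \ {0}` at which the space of degree-`d` homogeneous polynomials
with the prescribed multiplicities has dimension `max (vdim + 1) 0`
(the expected dimension). -/
noncomputable def nonSpecial (d : ℕ) (ms : List ℕ) : Prop :=
  ∃ pts : Fin ms.length → Fin 4 → ℚ,
    (∀ i, pts i ≠ 0) ∧
    (∀ i j, i ≠ j → LinearIndependent ℚ ![pts i, pts j]) ∧
    (Module.finrank ℚ (systemSpace d ms pts) : ℤ) = max (vdim d ms + 1) 0

lemma pderiv_commute (i j : Fin 4) :
    Commute ((pderiv (R := ℚ) i).toLinearMap : Module.End ℚ (MvPolynomial (Fin 4) ℚ))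
      (pderiv (R := ℚ) j).toLinearMap := by
  have h : ⁅(pderiv i : Derivation ℚ (MvPolynomial (Fin 4) ℚ) (MvPolynomial (Fin 4) ℚ)),
      (pderiv j : Derivation ℚ (MvPolynomial (Fin 4) ℚ) (MvPolynomial (Fin 4) ℚ))⁆ = 0 := by
    apply MvPolynomial.derivation_ext
    intro k
    rw [Derivation.commutator_apply]
    simp [pderiv_X, Pi.single_apply, apply_ite]
  apply LinearMap.ext
  intro f
  have := congrArg (fun D => D f) h
  rw [Derivation.commutator_apply] at this
  exact sub_eq_zero.mp this

lemma diffOp_add_single (ν : Fin 4 → ℕ) (j : Fin 4) :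
    diffOp (ν + Pi.single j 1) = diffOp ν * (pderiv j).toLinearMap := by
  have c := fun i j (n : ℕ) => ((pderiv_commute i j).pow_left n).eq
  have c' := fun i j (n : ℕ) (z : Module.End ℚ (MvPolynomial (Fin 4) ℚ)) =>
    ((pderiv_commute i j).pow_left n).left_comm z
  fin_cases j <;> simp [diffOp, pow_succ, mul_assoc, c, c']

lemma mem_van (m : ℕ) (p : Fin 4 → ℚ) (f) : f ∈ vanishingSpace m p ↔
    ∀ ν : Fin 4 → ℕ, ∑ j, ν j < m → aeval p (diffOp ν f) = 0 := by
  simp [vanishingSpace, Submodule.mem_iInf]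

lemma mem_van_zero (p : Fin 4 → ℚ) (f) : f ∈ vanishingSpace 0 p := by
  simp [mem_van]

lemma diffOp_zero : diffOp 0 = 1 := by simp [diffOp]

/-- The recursive description of the vanishing order. -/
lemma mem_van_succ (m : ℕ) (p : Fin 4 → ℚ) (f) : f ∈ vanishingSpace (m + 1) p ↔
    aeval p f = 0 ∧ ∀ j, pderiv j f ∈ vanishingSpace m p := by
  simp only [mem_van]
  constructor
  · intro h
    refine ⟨?_, fun j ν hν => ?_⟩
    · simpa [diffOp_zero] using h 0 (by simp)
    · have := h (ν + Pi.single j 1) (by simp [Finset.sum_add_distrib]; omega)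
      rw [diffOp_add_single] at this
      exact this
  · rintro ⟨h0, h⟩ ν hν
    by_cases hz : ν = 0
    · subst hz; simpa [diffOp_zero] using h0
    · obtain ⟨j, hj⟩ : ∃ j, ν j ≠ 0 := by
        by_contra! hh; exact hz (funext hh)
      have e : ν = (ν - Pi.single j 1) + Pi.single j 1 := by
        funext i
        by_cases hi : i = j
        · subst hi; simp; omega
        · simp [hi]
      rw [e, diffOp_add_single]
      refine h j _ ?_
      have : ∑ i, ν i = ∑ i, ((ν - Pi.single j 1) + Pi.single j 1 : Fin 4 → ℕ) i := by rw [← e]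
      rw [show ∑ i, ((ν - Pi.single j 1) + Pi.single j 1 : Fin 4 → ℕ) i
        = ∑ i, (ν - Pi.single j 1 : Fin 4 → ℕ) i + 1 by simp [Finset.sum_add_distrib]] at this
      omega

lemma van_mono (m : ℕ) (p : Fin 4 → ℚ) {f} (h : f ∈ vanishingSpace (m + 1) p) :
    f ∈ vanishingSpace m p := by
  rw [mem_van] at *
  exact fun ν hν => h ν (by omega)

lemma van_mul (m : ℕ) (p : Fin 4 → ℚ) : ∀ {f} (g) (_ : f ∈ vanishingSpace m p),
    g * f ∈ vanishingSpace m p := by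
  induction m with
  | zero => intros; exact mem_van_zero _ _
  | succ m ih =>
    intro f g h
    have h' := van_mono m p h
    rw [mem_van_succ] at h ⊢
    refine ⟨by rw [map_mul, h.1, mul_zero], fun j => ?_⟩
    rw [pderiv_mul]
    exact add_mem (ih _ h') (ih _ (h.2 j))

lemma van_of_mul (m : ℕ) (p : Fin 4 → ℚ) (u : MvPolynomial (Fin 4) ℚ) (hu : aeval p u ≠ 0) :
    ∀ {f} (_ : u * f ∈ vanishingSpace m p), f ∈ vanishingSpace m p := by
  induction m with
  | zero => intros; exact mem_van_zero _ _
  | succ m ih =>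
    intro f h
    have h' := ih (van_mono m p h)
    rw [mem_van_succ] at h ⊢
    refine ⟨(mul_eq_zero.mp ((map_mul (aeval p) u f).symm.trans h.1)).resolve_left hu, fun j => ih ?_⟩
    have := h.2 j
    rw [pderiv_mul] at this
    exact (Submodule.add_mem_iff_right _ (van_mul m p _ h')).mp this

/-- Linear substitution. -/
noncomputable def sub (θ : (Fin 4 → ℚ) →ₗ[ℚ] (Fin 4 → ℚ)) :
    MvPolynomial (Fin 4) ℚ →ₐ[ℚ] MvPolynomial (Fin 4) ℚ :=
  aeval (fun i => ∑ j, C (θ (Pi.single j 1) i) * X j)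

lemma aeval_sub (θ : (Fin 4 → ℚ) →ₗ[ℚ] (Fin 4 → ℚ)) (p : Fin 4 → ℚ) (f) :
    aeval p (sub θ f) = aeval (θ p) f := by
  have : ((aeval p).comp (sub θ) : MvPolynomial (Fin 4) ℚ →ₐ[ℚ] ℚ) = aeval (θ p) := by
    apply MvPolynomial.algHom_ext
    intro i
    simp only [AlgHom.comp_apply, sub, aeval_X, map_sum, map_mul, aeval_C]
    conv_rhs => rw [LinearMap.pi_apply_eq_sum_univ θ p]
    have e : ∀ x : Fin 4, (fun j => if x = j then (1 : ℚ) else 0) = Pi.single x 1 := by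
      intro x; funext j; simp [Pi.single_apply, eq_comm]
    simp [mul_comm, e]
  exact congrArg (fun F => F f) this

lemma pderiv_sub (θ : (Fin 4 → ℚ) →ₗ[ℚ] (Fin 4 → ℚ)) (j : Fin 4) (f) :
    pderiv j (sub θ f) = ∑ i, C (θ (Pi.single j 1) i) * sub θ (pderiv i f) := by
  induction f using MvPolynomial.induction_on with
  | C a => simp [sub]
  | add f g hf hg => simp [hf, hg, mul_add, Finset.sum_add_distrib]
  | mul_X f i hf =>
    have hx : pderiv j (sub θ (X i)) = C (θ (Pi.single j 1) i) := by
      simp [sub, pderiv_X, Pi.single_apply]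
    simp only [map_mul, pderiv_mul, hf, hx, pderiv_X, map_add, mul_add, Finset.sum_add_distrib,
      Finset.sum_mul]
    congr 1
    · simp [mul_assoc]
    · rw [Finset.sum_eq_single i]
      · simp [mul_comm]
      · intro b _ hb; simp [hb.symm]
      · simp

lemma van_sub (θ : (Fin 4 → ℚ) →ₗ[ℚ] (Fin 4 → ℚ)) (m : ℕ) (p : Fin 4 → ℚ) :
    ∀ {f} (_ : f ∈ vanishingSpace m (θ p)), sub θ f ∈ vanishingSpace m p := by
  induction m with
  | zero => intros; exact mem_van_zero _ _
  | succ m ih =>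
    intro f h
    rw [mem_van_succ] at h ⊢
    refine ⟨by rw [aeval_sub]; exact h.1, fun j => ?_⟩
    rw [pderiv_sub]
    exact sum_mem fun i _ => van_mul _ _ _ (ih (h.2 i))

lemma sub_homog (θ : (Fin 4 → ℚ) →ₗ[ℚ] (Fin 4 → ℚ)) (d : ℕ) {f} (h : f.IsHomogeneous d) :
    (sub θ f).IsHomogeneous d := by
  have := h.aeval (fun i => ∑ j, C (θ (Pi.single j 1) i) * X j) (n := 1) (fun i =>
    IsHomogeneous.sum _ _ _ fun j _ => by
      simpa using (isHomogeneous_C (Fin 4) _).mul (isHomogeneous_X ℚ j))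
  rw [one_mul] at this
  exact this

lemma sub_injective (θ : (Fin 4 → ℚ) ≃ₗ[ℚ] (Fin 4 → ℚ)) :
    Function.Injective (sub θ.toLinearMap) := by
  intro f g h
  apply MvPolynomial.funext
  intro x
  have := congrArg (aeval (θ.symm x)) h
  rw [aeval_sub, aeval_sub] at this
  simpa [aeval_eq_eval] using this

lemma van_monomial (m : ℕ) : ∀ (α : Fin 4 →₀ ℕ) (a : ℚ), m ≤ α 1 + α 2 + α 3 →
    monomial α a ∈ vanishingSpace m (Pi.single 0 1) := by
  induction m with
  | zero => intros; exact mem_van_zero _ _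
  | succ m ih =>
    intro α a h
    rw [mem_van_succ]
    constructor
    · rw [aeval_monomial, Finsupp.prod_fintype _ _ (by simp)]
      simp [Fin.prod_univ_four]
      omega
    · intro j
      rw [pderiv_monomial]
      apply ih
      fin_cases j <;> simp <;> omega

section LinAlg

open Polynomial in
/-- A determinant argument: the perturbation of the identity is invertible for almost all `t`. -/
lemma core {ι : Type*} [Fintype ι] [DecidableEq ι] (w : ι → ℕ) (k : ℕ) (A B : Matrix ι ι ℚ)
    (hA : ∀ q p, ¬ (w p ≤ k ∧ ¬ w q ≤ k) → A q p = 0)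
    (hB : ∀ p q, ¬ (¬ w q ≤ k ∧ w p ≤ k) → B p q = 0) :
    ∀ᶠ t in Filter.cofinite, ∀ x : ι → ℚ, (∀ q, ¬ w q ≤ k → x q = ∑ p, A q p * x p) →
      (∀ p, w p ≤ k → t ^ w p * x p = ∑ q, B p q * (t ^ w q * x q)) → x = 0 := by
  let N : Matrix ι ι ℚ[X] := fun p p' =>
    ∑ q, Polynomial.C (B p q * A q p') * Polynomial.X ^ (w q - w p)
  have hNe : ∀ (t : ℚ) p p', (Polynomial.evalRingHom t).mapMatrix N p p' =
      ∑ q, B p q * A q p' * t ^ (w q - w p) := by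
    intro t p p'
    change Polynomial.eval t (∑ q, Polynomial.C (B p q * A q p') * Polynomial.X ^ (w q - w p)) = _
    simp [Polynomial.eval_finset_sum]
  have hdet : (1 - N).det ≠ 0 := by
    intro h
    have h0 : (Polynomial.evalRingHom (0 : ℚ)) (1 - N).det = 0 := by rw [h, map_zero]
    rw [RingHom.map_det] at h0
    have : (Polynomial.evalRingHom (0 : ℚ)).mapMatrix (1 - N) = 1 := by
      rw [map_sub, map_one, sub_eq_self]
      ext p p'
      rw [hNe, Matrix.zero_apply]
      refine Finset.sum_eq_zero fun q _ => ?_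
      by_cases hh : ¬ w q ≤ k ∧ w p ≤ k
      · rw [zero_pow (by omega), mul_zero]
      · rw [hB p q hh]; simp
    rw [this] at h0
    simp at h0
  have hfin : ∀ᶠ t in Filter.cofinite, ¬ (1 - N).det.IsRoot t := by
    have := Polynomial.finite_setOfPred_isRoot hdet
    exact this.eventually_cofinite_notMem
  filter_upwards [hfin, Filter.eventually_cofinite_ne (0 : ℚ)] with t ht ht0 x hx1 hx2
  let y : ι → ℚ := fun p => if w p ≤ k then x p else 0
  have hxy : ∀ q p, A q p * x p = A q p * y p := by
    intro q p
    by_cases h : w p ≤ k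
    · simp [y, h]
    · rw [hA q p (by tauto)]; simp
  let M : Matrix ι ι ℚ := (Polynomial.evalRingHom t).mapMatrix (1 - N)
  have hM : M.det ≠ 0 := by
    intro h
    apply ht
    rw [← RingHom.map_det] at h
    exact h
  have hMy : M.mulVec y = 0 := by
    have hMN : M = 1 - (Polynomial.evalRingHom t).mapMatrix N := by
      simp only [M, map_sub, map_one]
    rw [hMN, Matrix.sub_mulVec, Matrix.one_mulVec, sub_eq_zero]
    funext p
    have hN : ((Polynomial.evalRingHom t).mapMatrix N).mulVec y p =
        ∑ q, B p q * t ^ (w q - w p) * ∑ p', A q p' * y p' := by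
      simp only [Matrix.mulVec, dotProduct, hNe, Finset.sum_mul, Finset.mul_sum]
      rw [Finset.sum_comm]
      refine Finset.sum_congr rfl fun q _ => Finset.sum_congr rfl fun p' _ => by ring
    rw [hN]
    by_cases hp : w p ≤ k
    · have h2 := hx2 p hp
      have : y p = x p := by simp [y, hp]
      rw [this]
      apply mul_left_cancel₀ (pow_ne_zero (w p) ht0)
      rw [h2, Finset.mul_sum]
      refine Finset.sum_congr rfl fun q _ => ?_
      by_cases hq : w q ≤ k
      · rw [hB p q (by tauto)]; simp
      · rw [hx1 q hq]
        simp only [hxy]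
        have : t ^ w q = t ^ w p * t ^ (w q - w p) := by rw [← pow_add]; congr 1; omega
        rw [this]; ring
    · have : y p = 0 := by simp [y, hp]
      rw [this]
      symm
      refine Finset.sum_eq_zero fun q _ => ?_
      rw [hB p q (by tauto)]; simp
  have hy : y = 0 := Matrix.eq_zero_of_mulVec_eq_zero hM hMy
  funext p
  by_cases hp : w p ≤ k
  · have := congrFun hy p
    simpa [y, hp] using this
  · rw [hx1 p hp]
    simp [hxy, hy]

variable {ι : Type*} [Fintype ι] [DecidableEq ι]

/-- Vectors whose coordinates in `s` vanish. -/
def zeroOn (s : ι → Prop) : Submodule ℚ (ι → ℚ) where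
  carrier := {c | ∀ p, s p → c p = 0}
  add_mem' := by
    intro a b ha hb p hp
    simp [ha p hp, hb p hp]
  zero_mem' := by intro p _; rfl
  smul_mem' := by
    intro c x hx p hp
    simp [hx p hp]

lemma mem_zeroOn (s : ι → Prop) (c : ι → ℚ) : c ∈ zeroOn s ↔ ∀ p, s p → c p = 0 := Iff.rfl

lemma finrank_zeroOn (s : ι → Prop) [DecidablePred s] :
    Module.finrank ℚ (zeroOn s) + Fintype.card {p // s p} = Fintype.card ι := by
  have h : zeroOn s = ⨅ i ∈ {p | s p}, LinearMap.ker (LinearMap.proj i : (ι → ℚ) →ₗ[ℚ] ℚ) := by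
    ext c
    simp [mem_zeroOn, Submodule.mem_iInf]
  have e := LinearMap.iInfKerProjEquiv ℚ (fun _ : ι => ℚ) (I := {p | ¬ s p}) (J := {p | s p})
    (by rw [Set.disjoint_left]; intro a h1 h2; exact h1 h2)
    (by intro a _; by_cases h : s a <;> simp [h])
  rw [h, e.finrank_eq, Module.finrank_fintype_fun_eq_card]
  have := Fintype.card_subtype_compl s
  have h2 := Fintype.card_subtype_le s
  rw [show Fintype.card ({p | ¬ s p} : Set ι) = Fintype.card {p // ¬ s p} from
    Fintype.card_congr (Equiv.refl _), this]
  omega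

lemma exists_graph (s : ι → Prop) [DecidablePred s] (W : Submodule ℚ (ι → ℚ))
    (h : W ⊓ zeroOn s = ⊥) :
    ∃ A : Matrix ι ι ℚ, (∀ q p, ¬ (s p ∧ ¬ s q) → A q p = 0) ∧
      ∀ x ∈ W, ∀ q, ¬ s q → x q = ∑ p, A q p * x p := by
  let π : (ι → ℚ) →ₗ[ℚ] (ι → ℚ) := LinearMap.pi fun p => if s p then LinearMap.proj p else 0
  have hπ : ∀ x p, π x p = if s p then x p else 0 := by
    intro x p
    by_cases hp : s p <;> simp [π, hp]
  have hinj : LinearMap.ker (π ∘ₗ W.subtype) = ⊥ := by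
    rw [LinearMap.ker_eq_bot']
    intro x hx
    have : (x : ι → ℚ) ∈ W ⊓ zeroOn s := by
      refine ⟨x.2, fun p hp => ?_⟩
      have := congrFun hx p
      simpa [hπ, hp] using this
    rw [h] at this
    exact Subtype.ext this
  obtain ⟨L, hL⟩ := LinearMap.exists_leftInverse_of_injective _ hinj
  refine ⟨fun q p => if s p ∧ ¬ s q then (L (Pi.single p 1) : ι → ℚ) q else 0, ?_, ?_⟩
  · intro q p hh; simp only [hh, if_false]
  · intro x hx q hq
    have h1 : (L (π x) : ι → ℚ) = x := by
      have := congrArg (fun F => (F ⟨x, hx⟩ : W)) hL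
      exact congrArg Subtype.val this
    have h2 : π x = ∑ p, π x p • Pi.single p (1 : ℚ) := (pi_eq_sum_univ' (π x)).trans (by
      refine Finset.sum_congr rfl fun p _ => ?_
      congr 1)
    conv_lhs => rw [← h1, h2]
    simp only [map_sum, map_smul, Submodule.coe_sum, Submodule.coe_smul, Finset.sum_apply,
      Pi.smul_apply, smul_eq_mul, hπ]
    refine Finset.sum_congr rfl fun p _ => ?_
    by_cases hp : s p <;> simp [hp, hq, mul_comm]

lemma exists_graph' (s : ι → Prop) [DecidablePred s] (W : Submodule ℚ (ι → ℚ))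
    (h : W ⊔ zeroOn s = ⊤) :
    ∃ A : Matrix ι ι ℚ, (∀ q p, ¬ (s p ∧ ¬ s q) → A q p = 0) ∧
      ∀ x : ι → ℚ, (fun q => if s q then x q else ∑ p, A q p * x p) ∈ W := by
  have : ∀ p : ι, ∃ u ∈ W, ∀ q, s q → u q = (Pi.single p 1 : ι → ℚ) q := by
    intro p
    have hp : (Pi.single p 1 : ι → ℚ) ∈ W ⊔ zeroOn s := by rw [h]; trivial
    obtain ⟨u, hu, v, hv, huv⟩ := Submodule.mem_sup.mp hp
    refine ⟨u, hu, fun q hq => ?_⟩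
    rw [← huv]
    simp [hv q hq]
  choose u hu hu2 using this
  refine ⟨fun q p => if s p ∧ ¬ s q then u p q else 0, ?_, ?_⟩
  · intro q p hh; simp only [hh, if_false]
  · intro x
    have : (fun q => if s q then x q else ∑ p, (if s p ∧ ¬ s q then u p q else 0) * x p)
      = ∑ p, (if s p then x p else 0) • u p := by
      funext q
      simp only [Finset.sum_apply, Pi.smul_apply, smul_eq_mul]
      by_cases hq : s q
      · simp [hq, hu2, Pi.single_apply]
      · simp only [hq, if_false]
        refine Finset.sum_congr rfl fun p _ => ?_
        by_cases hp : s p <;> simp [hp, mul_comm]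
    rw [this]
    exact sum_mem fun p _ => W.smul_mem _ (hu p)

/-- Weighted diagonal scaling. -/
def scale (w : ι → ℕ) (t : ℚ) : (ι → ℚ) →ₗ[ℚ] (ι → ℚ) where
  toFun c := fun p => t ^ w p * c p
  map_add' := by intro a b; funext p; simp [mul_add]
  map_smul' := by intro a b; funext p; simp; ring

lemma scale_apply (w : ι → ℕ) (t : ℚ) (c : ι → ℚ) (p : ι) : scale w t c p = t ^ w p * c p := rfl

lemma scale_injective (w : ι → ℕ) {t : ℚ} (ht : t ≠ 0) : Function.Injective (scale w t) := by
  intro a b h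
  funext p
  have := congrFun h p
  simpa [scale_apply, ht] using this

lemma glue_inj (w : ι → ℕ) (k : ℕ) (W E : Submodule ℚ (ι → ℚ))
    (hW : W ⊓ zeroOn (fun p => w p ≤ k) = ⊥) (hE : E ⊓ zeroOn (fun p => ¬ w p ≤ k) = ⊥) :
    ∀ᶠ t in Filter.cofinite, W ⊓ E.comap (scale w t) = ⊥ := by
  obtain ⟨A, hA, hA2⟩ := exists_graph _ W hW
  obtain ⟨B, hB, hB2⟩ := exists_graph _ E hE
  filter_upwards [core w k A B hA (fun p q h => hB p q (by tauto))] with t ht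
  rw [eq_bot_iff]
  rintro x ⟨hx1, hx2⟩
  exact ht x (hA2 x hx1) (fun p hp => hB2 _ hx2 p (by simpa using hp))

lemma glue_surj (w : ι → ℕ) (k : ℕ) (W E : Submodule ℚ (ι → ℚ))
    (hW : W ⊔ zeroOn (fun p => w p ≤ k) = ⊤) (hE : E ⊔ zeroOn (fun p => ¬ w p ≤ k) = ⊤) :
    ∀ᶠ t in Filter.cofinite, W.map (scale w t) ⊔ E = ⊤ := by
  obtain ⟨A, hA, hA2⟩ := exists_graph' _ W hW
  obtain ⟨B, hB, hB2⟩ := exists_graph' _ E hE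
  filter_upwards [core w k A B hA (fun p q h => hB p q (by tauto)),
    Filter.eventually_cofinite_ne (0 : ℚ)] with t ht ht0
  let Φ : (ι → ℚ) →ₗ[ℚ] (ι → ℚ) :=
    { toFun := fun x => scale w t (fun q => if w q ≤ k then x q else ∑ p, A q p * x p) +
        (fun q => if w q ≤ k then ∑ p, B q p * x p else x q)
      map_add' := by
        intro a b; funext q
        by_cases h : w q ≤ k <;>
          simp [scale_apply, h, mul_add, Finset.sum_add_distrib] <;> ring
      map_smul' := by
        intro a b; funext q
        by_cases h : w q ≤ k <;>
          simp [scale_apply, h, mul_add, Finset.mul_sum, mul_left_comm] }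
  have hΦ : ∀ x, Φ x = scale w t (fun q => if w q ≤ k then x q else ∑ p, A q p * x p) +
        (fun q => if w q ≤ k then ∑ p, B q p * x p else x q) := fun _ => rfl
  have hinj : Function.Injective Φ := by
    rw [← LinearMap.ker_eq_bot, LinearMap.ker_eq_bot']
    intro x hx
    let z : ι → ℚ := fun q => if w q ≤ k then x q else ∑ p, A q p * x p
    have hAz : ∀ q p, A q p * z p = A q p * x p := by
      intro q p
      by_cases hp : w p ≤ k
      · simp [z, hp]
      · rw [hA q p (by tauto)]; simp
    have hq : ∀ q, ¬ w q ≤ k → x q = - (t ^ w q * z q) := by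
      intro q hq
      have := congrFun hx q
      simp [hΦ, scale_apply, hq] at this
      simp only [z, hq, if_false]
      linarith
    have hz : z = 0 := by
      apply ht z
      · intro q hq
        simp only [hAz]
        simp [z, hq]
      · intro p hp
        have := congrFun hx p
        simp [hΦ, scale_apply, hp] at this
        have e : ∑ q, B p q * (t ^ w q * z q) = - ∑ q, B p q * x q := by
          rw [← Finset.sum_neg_distrib]
          refine Finset.sum_congr rfl fun q _ => ?_
          by_cases h : w q ≤ k
          · rw [hB p q (by tauto)]; simp
          · rw [hq q h]; ring
        rw [e]
        simp only [z, hp, if_true]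
        linarith
    funext p
    by_cases hp : w p ≤ k
    · have := congrFun hz p
      simpa [z, hp] using this
    · rw [hq p hp, hz]; simp
  have hsurj := LinearMap.injective_iff_surjective.mp hinj
  rw [eq_top_iff]
  intro v _
  obtain ⟨x, rfl⟩ := hsurj v
  rw [hΦ]
  exact add_mem (Submodule.mem_sup_left (Submodule.mem_map_of_mem (hA2 x)))
    (Submodule.mem_sup_right (by simpa only [ite_not] using hB2 x))

end LinAlg

/-- Exponents of degree `d` in four variables. -/
abbrev Ex (d : ℕ) : Type := ↥(Finset.finsuppAntidiag (Finset.univ : Finset (Fin 4)) d)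

lemma card_Ex (d : ℕ) : Fintype.card (Ex d) = (d + 3).choose 3 := by
  rw [Fintype.card_coe, Finset.card_finsuppAntidiag_nat_eq_choose]
  simp only [Finset.card_univ, Fintype.card_fin]
  rw [show 4 + d - 1 = d + 3 by omega, Nat.choose_symm_add]

lemma Ex_sum {d : ℕ} (α : Ex d) : α.1 0 + α.1 1 + α.1 2 + α.1 3 = d := by
  have := (Finset.mem_finsuppAntidiag.mp α.2).1
  rwa [Fin.sum_univ_four] at this

lemma mem_Ex {d : ℕ} (α : Fin 4 →₀ ℕ) (h : α 0 + α 1 + α 2 + α 3 = d) :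
    α ∈ Finset.finsuppAntidiag (Finset.univ : Finset (Fin 4)) d := by
  rw [Finset.mem_finsuppAntidiag, Fin.sum_univ_four]
  exact ⟨h, Finset.subset_univ _⟩

lemma degree4 (α : Fin 4 →₀ ℕ) : α.degree = α 0 + α 1 + α 2 + α 3 := by
  rw [Finsupp.degree_eq_sum, Fin.sum_univ_four]

/-- The weight, i.e. the order at the first coordinate point. -/
def wt {d : ℕ} (α : Ex d) : ℕ := α.1 1 + α.1 2 + α.1 3

/-- The polynomial with given coefficients. -/
noncomputable def toPoly (d : ℕ) : (Ex d → ℚ) →ₗ[ℚ] MvPolynomial (Fin 4) ℚ :=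
  ∑ α : Ex d, (monomial α.1) ∘ₗ LinearMap.proj α

lemma toPoly_apply (d : ℕ) (c : Ex d → ℚ) : toPoly d c = ∑ α : Ex d, monomial α.1 (c α) := by
  simp [toPoly]

lemma coeff_toPoly (d : ℕ) (c : Ex d → ℚ) (α : Ex d) : coeff α.1 (toPoly d c) = c α := by
  classical
  rw [toPoly_apply, coeff_sum, Finset.sum_eq_single α]
  · simp
  · intro β _ hβ
    rw [coeff_monomial, if_neg]
    exact fun h => hβ (Subtype.ext h)
  · simp

lemma toPoly_injective (d : ℕ) : Function.Injective (toPoly d) := by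
  intro a b h
  funext α
  rw [← coeff_toPoly d a α, ← coeff_toPoly d b α, h]

lemma toPoly_homog (d : ℕ) (c : Ex d → ℚ) : (toPoly d c).IsHomogeneous d := by
  rw [toPoly_apply]
  refine IsHomogeneous.sum _ _ _ fun α _ => isHomogeneous_monomial _ ?_
  rw [degree4, Ex_sum]

lemma exists_toPoly (d : ℕ) {f : MvPolynomial (Fin 4) ℚ} (hf : f.IsHomogeneous d) :
    ∃ c, toPoly d c = f := by
  refine ⟨fun α => coeff α.1 f, ?_⟩
  ext β
  by_cases h : β 0 + β 1 + β 2 + β 3 = d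
  · exact coeff_toPoly d _ ⟨β, mem_Ex β h⟩
  · rw [(toPoly_homog d _).coeff_eq_zero, hf.coeff_eq_zero] <;> rwa [degree4]

/-- The conditions imposed by a list of fat points. -/
noncomputable def TL (L : List (ℕ × (Fin 4 → ℚ))) : Submodule ℚ (MvPolynomial (Fin 4) ℚ) :=
  ⨅ x ∈ L, vanishingSpace x.1 x.2

lemma mem_TL (L : List (ℕ × (Fin 4 → ℚ))) (f) : f ∈ TL L ↔ ∀ x ∈ L, f ∈ vanishingSpace x.1 x.2 := by
  simp only [TL, Submodule.mem_iInf]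

/-- The system attached to a list of fat points. -/
noncomputable def Sys (d : ℕ) (L : List (ℕ × (Fin 4 → ℚ))) :
    Submodule ℚ (MvPolynomial (Fin 4) ℚ) := homogeneousSubmodule (Fin 4) ℚ d ⊓ TL L

/-- The same in coordinates. -/
noncomputable def SC (d : ℕ) (L : List (ℕ × (Fin 4 → ℚ))) : Submodule ℚ (Ex d → ℚ) :=
  (TL L).comap (toPoly d)

lemma mem_SC (d : ℕ) (L : List (ℕ × (Fin 4 → ℚ))) (c) :
    c ∈ SC d L ↔ ∀ x ∈ L, toPoly d c ∈ vanishingSpace x.1 x.2 := mem_TL _ _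

lemma SC_append (d : ℕ) (L L' : List (ℕ × (Fin 4 → ℚ))) : SC d (L ++ L') = SC d L ⊓ SC d L' := by
  ext c
  simp only [Submodule.mem_inf, mem_SC, List.mem_append]
  constructor
  · intro h; exact ⟨fun x hx => h x (Or.inl hx), fun x hx => h x (Or.inr hx)⟩
  · rintro ⟨h1, h2⟩ x (hx | hx)
    exacts [h1 x hx, h2 x hx]

lemma map_SC (d : ℕ) (L : List (ℕ × (Fin 4 → ℚ))) : (SC d L).map (toPoly d) = Sys d L := by
  ext f
  constructor
  · rintro ⟨c, hc, rfl⟩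
    exact ⟨toPoly_homog d c, hc⟩
  · rintro ⟨h1, h2⟩
    obtain ⟨c, rfl⟩ := exists_toPoly d h1
    exact ⟨c, h2, rfl⟩

lemma finrank_SC (d : ℕ) (L : List (ℕ × (Fin 4 → ℚ))) :
    Module.finrank ℚ (SC d L) = Module.finrank ℚ (Sys d L) := by
  rw [← map_SC]
  exact (Submodule.equivMapOfInjective _ (toPoly_injective d) _).finrank_eq

instance Sys_finite (d : ℕ) (L : List (ℕ × (Fin 4 → ℚ))) : Module.Finite ℚ (Sys d L) := by
  rw [← map_SC]; infer_instance

lemma finrank_Sys_map (d : ℕ) (L : List (ℕ × (Fin 4 → ℚ))) (θ : (Fin 4 → ℚ) ≃ₗ[ℚ] (Fin 4 → ℚ)) :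
    Module.finrank ℚ (Sys d (L.map (Prod.map id θ))) ≤ Module.finrank ℚ (Sys d L) := by
  rw [(Submodule.equivMapOfInjective (sub θ.toLinearMap).toLinearMap
    (sub_injective θ) (Sys d (L.map (Prod.map id θ)))).finrank_eq]
  apply Submodule.finrank_mono
  rintro _ ⟨f, ⟨h1, h2⟩, rfl⟩
  refine ⟨sub_homog _ _ h1, (mem_TL _ _).mpr fun x hx => ?_⟩
  exact van_sub θ.toLinearMap x.1 x.2
    ((mem_TL _ _).mp h2 (x.1, θ x.2) (List.mem_map.mpr ⟨x, hx, rfl⟩))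

lemma zeroOn_le (d m : ℕ) : zeroOn (fun α : Ex d => wt α < m) ≤ SC d [(m, Pi.single 0 1)] := by
  intro c hc
  rw [mem_SC]
  intro x hx
  rw [List.mem_singleton] at hx
  subst hx
  rw [toPoly_apply]
  refine sum_mem fun α _ => ?_
  by_cases h : wt α < m
  · rw [hc α h]; simp
  · exact van_monomial m _ _ (by simpa [wt] using h)

lemma card_wt_le (d k : ℕ) : Fintype.card {α : Ex d // wt α ≤ k} ≤ (k + 3).choose 3 := by
  rw [← card_Ex k]
  have hh : ∀ α : {α : Ex d // wt α ≤ k},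
      (α.1.1 + Finsupp.single 0 k - Finsupp.single 0 d) ∈
        Finset.finsuppAntidiag (Finset.univ : Finset (Fin 4)) k := by
    rintro ⟨α, hα⟩
    have := Ex_sum α
    have hw : wt α ≤ k := hα
    unfold wt at hw
    apply mem_Ex
    simp
    omega
  refine Fintype.card_le_of_injective (fun α => (⟨_, hh α⟩ : Ex k)) ?_
  rintro ⟨α, hα⟩ ⟨β, hβ⟩ h
  have h' := congrArg Subtype.val h
  have e := fun i => DFunLike.congr_fun h' i
  have h0 := e 0; have h1 := e 1; have h2 := e 2; have h3 := e 3
  have sa := Ex_sum α; have sb := Ex_sum β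
  have hwa : wt α ≤ k := hα
  have hwb : wt β ≤ k := hβ
  unfold wt at hwa hwb
  simp at h0 h1 h2 h3
  ext i
  fin_cases i <;> simp <;> omega

lemma card_wt_lt (d m : ℕ) : Fintype.card {α : Ex d // wt α < m} ≤ (m + 2).choose 3 := by
  cases m with
  | zero => simp
  | succ k =>
    have := card_wt_le d k
    simpa [Nat.lt_succ_iff] using this

lemma exists_move (p q : Fin 4 → ℚ) (hp : p ≠ 0) (hq : q ≠ 0) :
    ∃ θ : (Fin 4 → ℚ) ≃ₗ[ℚ] (Fin 4 → ℚ), θ p = q := by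
  obtain ⟨g, hg⟩ := Submodule.exists_linearEquiv_restrict_eq
    ((LinearEquiv.toSpanNonzeroSingleton ℚ _ p hp).symm ≪≫ₗ
      LinearEquiv.toSpanNonzeroSingleton ℚ _ q hq)
  refine ⟨g, ?_⟩
  have := hg ⟨p, Submodule.mem_span_singleton_self p⟩
  rw [← this]
  have h1 : (⟨p, Submodule.mem_span_singleton_self p⟩ : Submodule.span ℚ {p}) =
    LinearEquiv.toSpanNonzeroSingleton ℚ _ p hp 1 := by
    ext; simp
  rw [h1, LinearEquiv.trans_apply, LinearEquiv.symm_apply_apply]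
  simp

lemma codim_point (d m : ℕ) (p : Fin 4 → ℚ) (hp : p ≠ 0) :
    (d + 3).choose 3 ≤ Module.finrank ℚ (SC d [(m, p)]) + (m + 2).choose 3 := by
  obtain ⟨θ, hθ⟩ := exists_move p (Pi.single 0 1) hp (by simp)
  have h1 := finrank_Sys_map d [(m, p)] θ
  have e : [(m, p)].map (Prod.map id θ) = [(m, Pi.single 0 1)] := by simp [hθ]
  rw [e] at h1
  rw [← finrank_SC, ← finrank_SC] at h1
  have h2 := Submodule.finrank_mono (zeroOn_le d m)
  have h3 := finrank_zeroOn (fun α : Ex d => wt α < m)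
  have h4 := card_wt_lt d m
  rw [card_Ex] at h3
  omega

lemma codim_list (d : ℕ) (L : List (ℕ × (Fin 4 → ℚ))) (hL : ∀ x ∈ L, x.2 ≠ 0) :
    vdim d (L.map Prod.fst) + 1 ≤ Module.finrank ℚ (SC d L) := by
  induction L with
  | nil =>
    have : SC d [] = ⊤ := by
      rw [eq_top_iff]; intro c _; simp [mem_SC]
    rw [this, finrank_top, Module.finrank_fintype_fun_eq_card, card_Ex]
    simp [vdim]
  | cons x L ih =>
    have ih := ih fun y hy => hL y (List.mem_cons_of_mem _ hy)
    have h1 := codim_point d x.1 x.2 (hL x List.mem_cons_self)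
    have h2 := SC_append d [x] L
    have h3 := Submodule.finrank_sup_add_finrank_inf_eq (SC d [x]) (SC d L)
    have h4 := Submodule.finrank_le (SC d [x] ⊔ SC d L)
    rw [Module.finrank_fintype_fun_eq_card, card_Ex] at h4
    rw [← h2] at h3
    simp only [vdim, List.map_cons, List.sum_cons, List.singleton_append, List.map_map] at *
    zify at *
    linarith

/-- List version of non-speciality (as an upper bound). -/
def NS (d : ℕ) (L : List (ℕ × (Fin 4 → ℚ))) : Prop :=
  (∀ x ∈ L, x.2 ≠ 0) ∧ L.Pairwise (fun x y => LinearIndependent ℚ ![x.2, y.2]) ∧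
    (Module.finrank ℚ (SC d L) : ℤ) ≤ max (vdim d (L.map Prod.fst) + 1) 0

lemma NS_of (d : ℕ) (ms : List ℕ) (h : nonSpecial d ms) :
    ∃ L : List (ℕ × (Fin 4 → ℚ)), L.map Prod.fst = ms ∧ NS d L := by
  obtain ⟨pts, h1, h2, h3⟩ := h
  have hm : (List.ofFn fun i => (ms.get i, pts i)).map Prod.fst = ms := by
    rw [List.map_ofFn]
    exact List.ofFn_get ms
  refine ⟨List.ofFn (fun i => (ms.get i, pts i)), hm, ?_, ?_, ?_⟩
  · intro x hx
    rw [List.mem_ofFn] at hx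
    obtain ⟨i, rfl⟩ := hx
    exact h1 i
  · rw [List.pairwise_ofFn]
    intro i j hij
    exact h2 i j hij.ne
  · rw [hm, ← h3, finrank_SC]
    apply le_of_eq
    have : Sys d (List.ofFn fun i => (ms.get i, pts i)) = systemSpace d ms pts := by
      ext f
      simp only [Sys, systemSpace, Submodule.mem_inf, mem_TL, Submodule.mem_iInf, List.mem_ofFn,
        forall_exists_index, forall_apply_eq_imp_iff]
    rw [this]

lemma of_NS (d : ℕ) (L : List (ℕ × (Fin 4 → ℚ))) (h : NS d L) :
    nonSpecial d (L.map Prod.fst) := by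
  obtain ⟨h1, h2, h3⟩ := h
  have hl : (L.map Prod.fst).length = L.length := by simp
  refine ⟨fun i => (L.get (i.cast hl)).2, fun i => h1 _ (List.get_mem _ _), ?_, ?_⟩
  · rw [List.pairwise_iff_get] at h2
    intro i j hij
    rcases lt_or_gt_of_ne hij with h | h
    · exact h2 _ _ (by simpa using h)
    · rw [LinearIndependent.pair_symm_iff]
      exact h2 _ _ (by simpa using h)
  · have : systemSpace d (L.map Prod.fst) (fun i => (L.get (i.cast hl)).2) = Sys d L := by
      ext f
      simp only [Sys, systemSpace, Submodule.mem_inf, mem_TL, Submodule.mem_iInf]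
      refine and_congr_right fun _ => ?_
      constructor
      · intro h x hx
        obtain ⟨i, rfl⟩ := List.get_of_mem hx
        have := h (i.cast hl.symm)
        simpa using this
      · intro h i
        have := h (L.get (i.cast hl)) (List.get_mem _ _)
        simpa using this
    rw [this, ← finrank_SC]
    refine le_antisymm h3 (max_le (codim_list d L h1) (by positivity))

lemma NS_map (d : ℕ) (L : List (ℕ × (Fin 4 → ℚ))) (θ : (Fin 4 → ℚ) ≃ₗ[ℚ] (Fin 4 → ℚ))
    (h : NS d L) : NS d (L.map (Prod.map id θ)) := by
  obtain ⟨h1, h2, h3⟩ := h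
  refine ⟨?_, ?_, ?_⟩
  · intro x hx
    obtain ⟨y, hy, rfl⟩ := List.mem_map.mp hx
    simpa using h1 y hy
  · rw [List.pairwise_map]
    refine h2.imp fun {x y} hxy => ?_
    have := hxy.map' θ.toLinearMap θ.ker
    have e : ![(Prod.map id θ x).2, (Prod.map id θ y).2] = θ.toLinearMap ∘ ![x.2, y.2] := by
      funext i
      fin_cases i <;> rfl
    rw [e]
    exact this
  · have e : (L.map (Prod.map id θ)).map Prod.fst = L.map Prod.fst := by simp
    rw [e]
    refine le_trans ?_ h3
    rw [finrank_SC, finrank_SC]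
    exact_mod_cast finrank_Sys_map d L θ

lemma finrank_le_glue (d k : ℕ) (L : List (ℕ × (Fin 4 → ℚ))) (hL : ∀ x ∈ L, x.2 0 ≠ 0) :
    Module.finrank ℚ (SC d L ⊓ zeroOn (fun α : Ex d => ¬ wt α ≤ k) : Submodule ℚ (Ex d → ℚ))
      ≤ Module.finrank ℚ (SC k L) := by
  have hX : ∀ n : ℕ, (X 0 ^ n : MvPolynomial (Fin 4) ℚ) ≠ 0 := fun n => pow_ne_zero n (X_ne_zero 0)
  have hinj : ∀ d n : ℕ, Function.Injective
      ((LinearMap.mulLeft ℚ (X 0 ^ n : MvPolynomial (Fin 4) ℚ)) ∘ₗ toPoly d) := by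
    intro d n a b h
    exact toPoly_injective d (mul_left_cancel₀ (hX n) h)
  rw [(Submodule.equivMapOfInjective _ (hinj d k) _).finrank_eq,
    (Submodule.equivMapOfInjective _ (hinj k d) (SC k L)).finrank_eq]
  apply Submodule.finrank_mono
  rintro _ ⟨c, ⟨hc1, hc2⟩, rfl⟩
  let G : MvPolynomial (Fin 4) ℚ :=
    ∑ α : Ex d, monomial (α.1 + Finsupp.single 0 k - Finsupp.single 0 d) (c α)
  have hG : G.IsHomogeneous k := by
    refine IsHomogeneous.sum _ _ _ fun α _ => ?_
    by_cases h : wt α ≤ k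
    · apply isHomogeneous_monomial
      rw [degree4]
      have := Ex_sum α
      unfold wt at h
      simp
      omega
    · rw [hc2 α h, map_zero]
      exact isHomogeneous_zero _ _ _
  have hGX : X 0 ^ d * G = X 0 ^ k * toPoly d c := by
    rw [toPoly_apply, Finset.mul_sum, Finset.mul_sum]
    refine Finset.sum_congr rfl fun α _ => ?_
    by_cases h : wt α ≤ k
    · rw [X_pow_eq_monomial, X_pow_eq_monomial, monomial_mul, monomial_mul]
      congr 1
      have := Ex_sum α
      unfold wt at h
      congr 1
      ext i
      fin_cases i <;> simp <;> omega
    · rw [hc2 α h]; simp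
  obtain ⟨c', hc'⟩ := exists_toPoly k hG
  refine ⟨c', ?_, ?_⟩
  · refine (mem_SC _ _ _).mpr fun x hx => ?_
    apply van_of_mul x.1 x.2 (X 0 ^ d)
    · simp [hL x hx]
    · rw [hc', hGX]
      exact van_mul _ _ _ ((mem_SC _ _ _).mp hc1 x hx)
  · simp [hc', hGX]

/-- The degeneration `diag(1,t,t,t)`. -/
def gt (t : ℚ) : (Fin 4 → ℚ) →ₗ[ℚ] (Fin 4 → ℚ) where
  toFun x := ![x 0, t * x 1, t * x 2, t * x 3]
  map_add' := by intro a b; funext i; fin_cases i <;> simp [mul_add]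
  map_smul' := by intro a b; funext i; fin_cases i <;> simp [mul_left_comm]

lemma gt_apply (t : ℚ) (x : Fin 4 → ℚ) : gt t x = ![x 0, t * x 1, t * x 2, t * x 3] := rfl

lemma gt_injective {t : ℚ} (ht : t ≠ 0) : Function.Injective (gt t) := by
  intro a b h
  have h0 := congrFun h 0
  have h1 := congrFun h 1
  have h2 := congrFun h 2
  have h3 := congrFun h 3
  simp [gt_apply, ht] at h0 h1 h2 h3
  funext i
  fin_cases i <;> assumption

lemma toPoly_scale (d : ℕ) (t : ℚ) (c : Ex d → ℚ) :
    toPoly d (scale wt t c) = sub (gt t) (toPoly d c) := by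
  apply MvPolynomial.funext
  intro x
  have := aeval_sub (gt t) x (toPoly d c)
  rw [aeval_eq_eval, aeval_eq_eval] at this
  change eval x _ = eval x _
  refine Eq.trans ?_ this.symm
  simp only [toPoly_apply, map_sum]
  change _ = ∑ α : Ex d, eval (gt t x) (monomial α.1 (c α))
  refine Finset.sum_congr rfl fun α _ => ?_
  rw [eval_monomial, eval_monomial, Finsupp.prod_fintype _ _ (by simp),
    Finsupp.prod_fintype _ _ (by simp)]
  simp only [Fin.prod_univ_four, scale_apply, gt_apply, wt]
  simp [mul_pow, pow_add]
  ring

lemma SC_gt (d : ℕ) (t : ℚ) (L : List (ℕ × (Fin 4 → ℚ))) :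
    SC d (L.map (Prod.map id (gt t))) ≤ (SC d L).comap (scale wt t) := by
  intro c hc
  rw [Submodule.mem_comap, mem_SC]
  intro x hx
  rw [toPoly_scale]
  exact van_sub _ _ _ ((mem_SC _ _ _).mp hc (x.1, gt t x.2) (List.mem_map.mpr ⟨x, hx, rfl⟩))

lemma indep_of_minor (p q : Fin 4 → ℚ) (i j : Fin 4) (h : p i * q j - p j * q i ≠ 0) :
    LinearIndependent ℚ ![p, q] := by
  rw [LinearIndependent.pair_iff]
  intro a b hab
  have hi := congrFun hab i
  have hj := congrFun hab j
  simp at hi hj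
  constructor
  · have : a * (p i * q j - p j * q i) = 0 := by linear_combination q j * hi - q i * hj
    exact (mul_eq_zero.mp this).resolve_right h
  · have : b * (p i * q j - p j * q i) = 0 := by linear_combination p i * hj - p j * hi
    exact (mul_eq_zero.mp this).resolve_right h

lemma eventually_indep (p b : Fin 4 → ℚ) (hp : LinearIndependent ℚ ![p, Pi.single 0 1])
    (hb : b 0 ≠ 0) : ∀ᶠ t in Filter.cofinite, LinearIndependent ℚ ![p, gt t b] := by
  have : ∃ i : Fin 4, i ≠ 0 ∧ p i ≠ 0 := by
    by_contra! h
    rw [LinearIndependent.pair_iff] at hp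
    have := hp 1 (- p 0) (by
      funext i
      by_cases hi : i = 0
      · subst hi; simp
      · simp [hi, h i hi])
    simp at this
  obtain ⟨i, hi, hpi⟩ := this
  have hne : ∀ᶠ t : ℚ in Filter.cofinite, p 0 * (t * b i) - p i * b 0 ≠ 0 := by
    by_cases hz : p 0 * b i = 0
    · refine Filter.Eventually.of_forall fun t => ?_
      have : p 0 * (t * b i) = 0 := by rw [mul_left_comm, hz, mul_zero]
      rw [this, zero_sub, neg_ne_zero]
      exact mul_ne_zero hpi hb
    · filter_upwards [Filter.eventually_cofinite_ne (p i * b 0 / (p 0 * b i))] with t ht h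
      apply ht
      rw [eq_div_iff hz]
      linear_combination h
  filter_upwards [hne] with t ht
  apply indep_of_minor p _ 0 i
  have : gt t b i = t * b i := by fin_cases i <;> simp_all [gt_apply]
  rw [this]
  exact ht

/-- The shear used to make first coordinates nonzero. -/
def shear (s : ℚ) : (Fin 4 → ℚ) ≃ₗ[ℚ] (Fin 4 → ℚ) where
  toFun x := ![x 0 + s * x 1 + s ^ 2 * x 2 + s ^ 3 * x 3, x 1, x 2, x 3]
  invFun x := ![x 0 - s * x 1 - s ^ 2 * x 2 - s ^ 3 * x 3, x 1, x 2, x 3]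
  map_add' := by intro a b; funext i; fin_cases i <;> simp; ring
  map_smul' := by intro a b; funext i; fin_cases i <;> simp; ring
  left_inv := by intro a; funext i; fin_cases i <;> simp; ring
  right_inv := by intro a; funext i; fin_cases i <;> simp; ring

lemma eventually_shear (b : Fin 4 → ℚ) (hb : b ≠ 0) :
    ∀ᶠ s in Filter.cofinite, shear s b 0 ≠ 0 := by
  let P : Polynomial ℚ := Polynomial.C (b 0) + Polynomial.C (b 1) * Polynomial.X +
    Polynomial.C (b 2) * Polynomial.X ^ 2 + Polynomial.C (b 3) * Polynomial.X ^ 3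
  have hP : P ≠ 0 := by
    intro h
    apply hb
    have e := fun n => congrArg (fun Q => Polynomial.coeff Q n) h
    have h0 := e 0; have h1 := e 1; have h2 := e 2; have h3 := e 3
    simp [P, Polynomial.coeff_X, Polynomial.coeff_C, Polynomial.coeff_X_pow] at h0 h1 h2 h3
    funext i
    fin_cases i <;> assumption
  have := (Polynomial.finite_setOfPred_isRoot hP).eventually_cofinite_notMem
  filter_upwards [this] with s hs h
  apply hs
  change Polynomial.eval s P = 0
  have h' : b 0 + s * b 1 + s ^ 2 * b 2 + s ^ 3 * b 3 = 0 := h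
  simp [P]
  linear_combination h'

/-- Eventual statements over finite lists. -/
lemma eventually_list {α : Type*} (L : List α) (P : α → ℚ → Prop)
    (h : ∀ x ∈ L, ∀ᶠ t in Filter.cofinite, P x t) :
    ∀ᶠ t in Filter.cofinite, ∀ x ∈ L, P x t := by
  induction L with
  | nil => simp
  | cons a L ih =>
    filter_upwards [h a List.mem_cons_self, ih fun x hx => h x (List.mem_cons_of_mem _ hx)]
      with t h1 h2 x hx
    rcases List.mem_cons.mp hx with rfl | hx
    exacts [h1, h2 x hx]

/-- The number of conditions. -/
def condCount (ms : List ℕ) : ℤ := (ms.map fun m => ((m + 2).choose 3 : ℤ)).sum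

lemma vdim_eq (d : ℕ) (ms : List ℕ) : vdim d ms = ((d + 3).choose 3 : ℤ) - condCount ms - 1 := rfl

lemma condCount_append (A B : List ℕ) : condCount (A ++ B) = condCount A + condCount B := by
  simp [condCount]

lemma glue_bound (d k : ℕ) (Lp Lb : List (ℕ × (Fin 4 → ℚ)))
    (h2 : NS d (Lp ++ [(k + 1, Pi.single 0 1)])) (hb : NS k Lb) (hb0 : ∀ x ∈ Lb, x.2 0 ≠ 0)
    (hv : (-1 ≤ vdim d (Lp.map Prod.fst ++ [k + 1]) ∧
            vdim d (Lp.map Prod.fst ++ [k + 1]) ≤ vdim d (Lp.map Prod.fst ++ Lb.map Prod.fst)) ∨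
          (vdim d (Lp.map Prod.fst ++ Lb.map Prod.fst) ≤ vdim d (Lp.map Prod.fst ++ [k + 1]) ∧
            vdim d (Lp.map Prod.fst ++ [k + 1]) ≤ -1)) :
    ∀ᶠ t in Filter.cofinite,
      (Module.finrank ℚ (SC d Lp ⊓ (SC d Lb).comap (scale wt t) : Submodule ℚ (Ex d → ℚ)) : ℤ) ≤
        max (vdim d (Lp.map Prod.fst ++ Lb.map Prod.fst) + 1) 0 := by
  have hW := codim_list d Lp fun x hx => h2.1 x (List.mem_append_left _ hx)
  have hE := codim_list d Lb hb.1
  have hWV : (Module.finrank ℚ (SC d Lp ⊓ zeroOn (fun α : Ex d => wt α ≤ k) :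
      Submodule ℚ (Ex d → ℚ)) : ℤ) ≤ max (vdim d (Lp.map Prod.fst ++ [k + 1]) + 1) 0 := by
    have h := h2.2.2
    rw [List.map_append, SC_append] at h
    refine le_trans ?_ h
    have : zeroOn (fun α : Ex d => wt α ≤ k) ≤ SC d [(k + 1, Pi.single 0 1)] := by
      have := zeroOn_le d (k + 1)
      simpa only [Nat.lt_succ_iff] using this
    exact_mod_cast Submodule.finrank_mono (inf_le_inf_left _ this)
  have hEV := finrank_le_glue d k Lb hb0
  have hEk := hb.2.2
  have hP := card_wt_le d k
  have hV1 := finrank_zeroOn (fun α : Ex d => wt α ≤ k)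
  have hV2 := finrank_zeroOn (fun α : Ex d => ¬ wt α ≤ k)
  have hcc := Fintype.card_subtype_compl (fun α : Ex d => wt α ≤ k)
  have hcl := Fintype.card_subtype_le (fun α : Ex d => wt α ≤ k)
  have hs1 := Submodule.finrank_sup_add_finrank_inf_eq (SC d Lp)
    (zeroOn (fun α : Ex d => wt α ≤ k))
  have hs2 := Submodule.finrank_sup_add_finrank_inf_eq (SC d Lb)
    (zeroOn (fun α : Ex d => ¬ wt α ≤ k))
  have hl1 := Submodule.finrank_le (SC d Lp ⊔ zeroOn (fun α : Ex d => wt α ≤ k))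
  have hl2 := Submodule.finrank_le (SC d Lb ⊔ zeroOn (fun α : Ex d => ¬ wt α ≤ k))
  have hc1 : condCount [k + 1] = ((k + 3).choose 3 : ℤ) := by simp [condCount]
  have htop : Module.finrank ℚ (Ex d → ℚ) = (d + 3).choose 3 := by
    rw [Module.finrank_fintype_fun_eq_card, card_Ex]
  rw [htop] at hl1 hl2
  rw [card_Ex] at hV1 hV2 hcc hcl
  simp only [vdim_eq, condCount_append, hc1] at *
  rcases hv with ⟨hva, hvb⟩ | ⟨hva, hvb⟩
  · rw [max_eq_left (by linarith)] at hWV hEk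
    have t1 : SC d Lp ⊔ zeroOn (fun α : Ex d => wt α ≤ k) = ⊤ := by
      apply Submodule.eq_top_of_finrank_eq
      rw [htop]
      omega
    have t2 : SC d Lb ⊔ zeroOn (fun α : Ex d => ¬ wt α ≤ k) = ⊤ := by
      apply Submodule.eq_top_of_finrank_eq
      rw [htop]
      omega
    filter_upwards [glue_surj wt k _ _ t1 t2, Filter.eventually_cofinite_ne (0 : ℚ)] with t ht ht0
    have hi := scale_injective (wt (d := d)) ht0
    have hs3 := Submodule.finrank_sup_add_finrank_inf_eq ((SC d Lp).map (scale wt t)) (SC d Lb)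
    rw [ht, finrank_top, htop, ← (Submodule.equivMapOfInjective _ hi (SC d Lp)).finrank_eq] at hs3
    have hle : Module.finrank ℚ
        (SC d Lp ⊓ (SC d Lb).comap (scale wt t) : Submodule ℚ (Ex d → ℚ)) ≤
        Module.finrank ℚ ((SC d Lp).map (scale wt t) ⊓ SC d Lb : Submodule ℚ (Ex d → ℚ)) := by
      rw [(Submodule.equivMapOfInjective _ hi
        (SC d Lp ⊓ (SC d Lb).comap (scale wt t))).finrank_eq]
      apply Submodule.finrank_mono
      rintro _ ⟨x, ⟨hx1, hx2⟩, rfl⟩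
      exact ⟨⟨x, hx1, rfl⟩, hx2⟩
    refine le_max_of_le_left ?_
    omega
  · rw [max_eq_right (by linarith)] at hWV hEk
    have t1 : SC d Lp ⊓ zeroOn (fun α : Ex d => wt α ≤ k) = ⊥ := by
      apply Submodule.finrank_eq_zero.mp
      omega
    have t2 : SC d Lb ⊓ zeroOn (fun α : Ex d => ¬ wt α ≤ k) = ⊥ := by
      apply Submodule.finrank_eq_zero.mp
      omega
    filter_upwards [glue_inj wt k _ _ t1 t2] with t ht
    rw [ht]
    simp

lemma glue_main (d k : ℕ) (Lp Lb : List (ℕ × (Fin 4 → ℚ)))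
    (h2 : NS d (Lp ++ [(k + 1, Pi.single 0 1)])) (hb : NS k Lb) (hb0 : ∀ x ∈ Lb, x.2 0 ≠ 0)
    (hv : (-1 ≤ vdim d (Lp.map Prod.fst ++ [k + 1]) ∧
            vdim d (Lp.map Prod.fst ++ [k + 1]) ≤ vdim d (Lp.map Prod.fst ++ Lb.map Prod.fst)) ∨
          (vdim d (Lp.map Prod.fst ++ Lb.map Prod.fst) ≤ vdim d (Lp.map Prod.fst ++ [k + 1]) ∧
            vdim d (Lp.map Prod.fst ++ [k + 1]) ≤ -1)) :
    ∃ t : ℚ, NS d (Lp ++ Lb.map (Prod.map id (gt t))) := by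
  have hpw := List.pairwise_append.mp h2.2.1
  have e1 : ∀ᶠ t in Filter.cofinite, ∀ x ∈ Lp, ∀ y ∈ Lb,
      LinearIndependent ℚ ![x.2, gt t y.2] := by
    refine eventually_list Lp (fun x t => ∀ y ∈ Lb, LinearIndependent ℚ ![x.2, gt t y.2]) ?_
    intro x hx
    refine eventually_list Lb (fun y t => LinearIndependent ℚ ![x.2, gt t y.2]) ?_
    intro y hy
    have h := hpw.2.2 x hx (k + 1, Pi.single 0 1) (List.mem_singleton.mpr rfl)
    exact eventually_indep x.2 y.2 h (hb0 y hy)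
  obtain ⟨t, ht1, ht2, ht0⟩ := (e1.and ((glue_bound d k Lp Lb h2 hb hb0 hv).and
    (Filter.eventually_cofinite_ne (0 : ℚ)))).exists
  have hinj := gt_injective ht0
  refine ⟨t, ?_, ?_, ?_⟩
  · intro x hx
    rcases List.mem_append.mp hx with hx | hx
    · exact h2.1 x (List.mem_append_left _ hx)
    · obtain ⟨y, hy, rfl⟩ := List.mem_map.mp hx
      intro h
      exact hb.1 y hy (hinj (by simpa using h))
  · rw [List.pairwise_append]
    refine ⟨hpw.1, ?_, ?_⟩
    · rw [List.pairwise_map]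
      refine hb.2.1.imp fun {x y} hxy => ?_
      have := hxy.map' (gt t) (LinearMap.ker_eq_bot.mpr hinj)
      have e : ![(Prod.map id (gt t) x).2, (Prod.map id (gt t) y).2] = gt t ∘ ![x.2, y.2] := by
        funext i
        fin_cases i <;> rfl
      rw [e]
      exact this
    · intro x hx y hy
      obtain ⟨z, hz, rfl⟩ := List.mem_map.mp hy
      exact ht1 x hx z hz
  · have e : (Lp ++ Lb.map (Prod.map id (gt t))).map Prod.fst =
        Lp.map Prod.fst ++ Lb.map Prod.fst := by simp
    rw [e, SC_append]
    refine le_trans ?_ ht2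
    exact_mod_cast Submodule.finrank_mono (inf_le_inf_left _ (SC_gt d t Lb))

/-- Glueing theorem: if `L_3(k; ℓ₁^{×s₁}, ℓ₂^{×s₂})` is non-special and the virtual
dimensions of `L₁ = L_3(d; m_1,…,m_r, ℓ₁^{×s₁}, ℓ₂^{×s₂})` and `L₂ = L_3(d; m_1,…,m_r, k+1)`
satisfy `−1 ≤ vdim L₂ ≤ vdim L₁` or `vdim L₁ ≤ vdim L₂ ≤ −1`, then non-specialty of `L₂`
implies non-specialty of `L₁`. -/
theorem glueing (d k : ℕ) (ms : List ℕ) (ℓ₁ ℓ₂ s₁ s₂ : ℕ)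
    (hglue : nonSpecial k (List.replicate s₁ ℓ₁ ++ List.replicate s₂ ℓ₂))
    (hv : (-1 ≤ vdim d (ms ++ [k + 1]) ∧
            vdim d (ms ++ [k + 1]) ≤
              vdim d (ms ++ List.replicate s₁ ℓ₁ ++ List.replicate s₂ ℓ₂)) ∨
          (vdim d (ms ++ List.replicate s₁ ℓ₁ ++ List.replicate s₂ ℓ₂) ≤
              vdim d (ms ++ [k + 1]) ∧
            vdim d (ms ++ [k + 1]) ≤ -1))
    (h2 : nonSpecial d (ms ++ [k + 1])) :
    nonSpecial d (ms ++ List.replicate s₁ ℓ₁ ++ List.replicate s₂ ℓ₂) := by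
  obtain ⟨L2, hL2, hN2⟩ := NS_of _ _ h2
  obtain ⟨Lb, hLb, hNb⟩ := NS_of _ _ hglue
  obtain ⟨Lp, Lq, rfl, hLp, hLq⟩ := List.map_eq_append_iff.mp hL2
  obtain ⟨⟨m, q⟩, rfl, hq⟩ := List.map_eq_singleton_iff.mp hLq
  obtain rfl : m = k + 1 := hq
  obtain ⟨θ, hθ⟩ := exists_move q (Pi.single 0 1)
    (hN2.1 (k + 1, q) (List.mem_append_right _ (List.mem_singleton_self _))) (by simp)
  have hN2' := NS_map d _ θ hN2
  obtain ⟨s, hs⟩ := (eventually_list Lb (fun x s => shear s x.2 0 ≠ 0)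
    fun x hx => eventually_shear x.2 (hNb.1 x hx)).exists
  have hNb' := NS_map k _ (shear s) hNb
  have e1 : (Lp ++ [(k + 1, q)]).map (Prod.map id θ) =
      Lp.map (Prod.map id θ) ++ [(k + 1, Pi.single 0 1)] := by simp [hθ]
  rw [e1] at hN2'
  have e2 : (Lp.map (Prod.map id θ)).map Prod.fst = ms := by rw [← hLp]; simp
  have e3 : (Lb.map (Prod.map id (shear s))).map Prod.fst =
      List.replicate s₁ ℓ₁ ++ List.replicate s₂ ℓ₂ := by rw [← hLb]; simp
  obtain ⟨t, ht⟩ := glue_main d k _ _ hN2' hNb' (by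
    intro x hx
    obtain ⟨y, hy, rfl⟩ := List.mem_map.mp hx
    exact hs y hy) (by
    rw [e2, e3, ← List.append_assoc]
    exact hv)
  have := of_NS _ _ ht
  have e4 : (Lp.map (Prod.map id θ) ++ (Lb.map (Prod.map id (shear s))).map
      (Prod.map id (gt t))).map Prod.fst = ms ++ List.replicate s₁ ℓ₁ ++ List.replicate s₂ ℓ₂ := by
    rw [List.append_assoc, ← e3, ← e2]; simp
  rwa [e4] at this
end

section
/- For all non-negative integers a, b with 2a + b = 22, the system L_3(9; 4^{×a}, 3^{×b}) is non-special of virtual dimension −1; that is, there exist a + b pairwise linearly independent points in ℚ^4 \ {0} such that the only homogeneous polynomial of degree 9 in 4 variables over ℚ vanishing to order ≥ 4 at the first a points and to order ≥ 3 at the remaining b points is the zero polynomial, and indeed C(12,3) − 20a − 10b − 1 = 220 − 10(2a+b) − 1 = −1. -/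
open MvPolynomial

/-! ### Kernel-friendly Gaussian elimination modulo 127 on packed rows (16-bit digits) -/

/-- Forces the evaluation of a natural number before continuing. -/
def forceNat {α : Type} (n : ℕ) (k : ℕ → α) : α :=
  Nat.rec (motive := fun _ => α) (k 0) (fun m _ => k (Nat.succ m)) n

/-- One step of digitwise reduction modulo `127 = 2^7 - 1`. -/
def fold1 (m1 m2 N : ℕ) : ℕ :=
  Nat.add (Nat.land N m1) (Nat.land (Nat.div N 128) m2)

/-- Eliminate the lowest digit of all rows using the pivot `q` (lowest digit `-1`). -/
def stepAll (m1 m2 q : ℕ) (rows : List ℕ) : List ℕ → List ℕ :=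
  List.rec (motive := fun _ => List ℕ → List ℕ) (fun acc => acc)
    (fun r _ ih acc =>
      forceNat (Nat.add r (Nat.mul (Nat.mod r 65536) q)) fun v =>
      forceNat (fold1 m1 m2 v) fun v =>
      forceNat (Nat.div (fold1 m1 m2 v) 65536) fun v => ih (List.cons v acc)) rows

/-- Finds a row with nonzero lowest digit, and passes it on with the other rows. -/
def pickRow (k : ℕ → List ℕ → Bool) (rows : List ℕ) : List ℕ → Bool :=
  List.rec (motive := fun _ => List ℕ → Bool) (fun _ => false)
    (fun r rs ih acc =>
      Bool.rec (motive := fun _ => Bool) (k r (List.append acc rs)) (ih (List.cons r acc))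
        (Nat.beq (Nat.mod (Nat.mod r 65536) 127) 0)) rows

/-- The elimination; `true` certifies that the rows have full column rank `n` mod 127. -/
def elimRows (n : ℕ) : ℕ → ℕ → List ℕ → Bool :=
  Nat.rec (motive := fun _ => ℕ → ℕ → List ℕ → Bool) (fun _ _ _ => true)
    (fun _ ih m1 m2 rows =>
      pickRow (fun r rest =>
        forceNat (Nat.mul (Nat.mod (Nat.pow (Nat.sub 254 (Nat.mod r 65536)) 125) 127) r) fun v =>
        forceNat (fold1 m1 m2 v) fun v =>
        forceNat (fold1 m1 m2 v) fun q =>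
        Bool.rec (motive := fun _ => Bool) false
          (forceNat (Nat.div m1 65536) fun m1b => forceNat (Nat.div m2 65536) fun m2b =>
            ih m1b m2b (stepAll m1 m2 q rest List.nil))
          (Nat.beq (Nat.mod (Nat.succ (Nat.mod q 65536)) 127) 0)) rows List.nil) n

/-- The number all of whose `n` lowest base-65536 digits are `v`. -/
def maskNat (v : ℕ) : ℕ → ℕ
  | 0 => 0
  | n + 1 => v + 65536 * maskNat v n

/-- Exponents of `x₁, x₂, x₃` in the monomials of degree 9. -/
def expList : List (ℕ × ℕ × ℕ) :=
  (List.range 10).flatMap fun i => (List.range (10 - i)).flatMap fun j =>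
    (List.range (10 - i - j)).map fun k => (i, j, k)

/-- Multi-indices of order `< m` in three variables. -/
def nuList (m : ℕ) : List (ℕ × ℕ × ℕ) :=
  (List.range m).flatMap fun i => (List.range (m - i)).flatMap fun j =>
    (List.range (m - i - j)).map fun k => (i, j, k)

/-- Descending factorial, in a form which the kernel evaluates quickly. -/
def descFac (e i : ℕ) : ℕ :=
  Nat.rec (motive := fun _ => ℕ) 1 (fun k ih => Nat.mul (Nat.sub e k) ih) i

/-- `∂^i x^e` at `x`. -/
def gEntry (x i e : ℕ) : ℕ := Nat.mul (descFac e i) (Nat.pow x (Nat.sub e i))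

/-- The packed row (mod 127) of the condition `∂^(i,j,k) f (1,x,y,z) = 0`. -/
def rowNat (x y z i j k : ℕ) (E : List (ℕ × ℕ × ℕ)) : ℕ :=
  List.rec (motive := fun _ => ℕ) 0
    (fun e _ ih => Prod.rec (motive := fun _ => ℕ) (fun e1 eb =>
      Prod.rec (motive := fun _ => ℕ) (fun e2 e3 =>
        Nat.add (Nat.mod (Nat.mul (gEntry x i e1) (Nat.mul (gEntry y j e2) (gEntry z k e3))) 127)
          (Nat.mul 65536 ih)) eb) e) E

/-- Evaluates all the numbers in a list of triples before continuing; reverses the list. -/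
def forceTriples {α : Type} (k : List (ℕ × ℕ × ℕ) → α) (l : List (ℕ × ℕ × ℕ)) :
    List (ℕ × ℕ × ℕ) → α :=
  List.rec (motive := fun _ => List (ℕ × ℕ × ℕ) → α) (fun acc => k acc)
    (fun e _ ih acc => forceNat e.1 fun a => forceNat e.2.1 fun b => forceNat e.2.2 fun c =>
      ih (List.cons (a, b, c) acc)) l

/-- The 22 points (affine coordinates). -/
def ptList : List (ℕ × ℕ × ℕ) :=
  [(27, 27, 1), (2, 2, 11), (26, 5, 23), (25, 21, 27), (9, 8, 19), (6, 19, 1), (18, 21, 5),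
   (13, 20, 12), (25, 23, 27), (16, 11, 17), (29, 14, 16), (8, 28, 1), (27, 0, 11), (14, 29, 10),
   (29, 12, 13), (28, 28, 16), (5, 17, 5), (7, 7, 0), (5, 10, 5), (4, 16, 16), (11, 16, 21),
   (17, 5, 28)]

/-- Evaluates the rows of all conditions `ν ∈ ns` at the point `P` before continuing. -/
def withRows {α : Type} (E : List (ℕ × ℕ × ℕ)) (P : ℕ × ℕ × ℕ) (k : List ℕ → α)
    (ns : List (ℕ × ℕ × ℕ)) : List ℕ → α :=
  List.rec (motive := fun _ => List ℕ → α) (fun acc => k acc)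
    (fun ν _ ih acc => forceNat (rowNat P.1 P.2.1 P.2.2 ν.1 ν.2.1 ν.2.2 E) fun v =>
      ih (List.cons v acc)) ns

/-- Evaluates the rows of all conditions `ν ∈ ns` at all points before continuing. -/
def withRowsAll {α : Type} (E ns : List (ℕ × ℕ × ℕ)) (k : List (List ℕ) → α)
    (ps : List (ℕ × ℕ × ℕ)) : List (List ℕ) → α :=
  List.rec (motive := fun _ => List (List ℕ) → α) (fun acc => k acc)
    (fun P _ ih acc => withRows E P (fun l => ih (List.cons l acc)) ns List.nil) ps

/-- The whole check for `a` points of multiplicity 4 and `22 - 2 * a` points of multiplicity 3. -/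
def checkAll (a : ℕ) : Bool :=
  forceNat (maskNat 127 220) fun m1 => forceNat (maskNat 511 220) fun m2 =>
  forceTriples (fun E => forceTriples (fun n3 => forceTriples (fun n4 =>
    withRowsAll E n4 (fun R4 => withRowsAll E n3 (fun R3 =>
      elimRows 220 m1 m2 (R4.flatten ++ R3.flatten))
      ((ptList.drop a).take (22 - 2 * a)) []) (ptList.take a) [])
    (nuList 4) []) (nuList 3) []) expList []

/-! ### The twelve computations -/

theorem checkAll_0 : checkAll 0 = true := by decide +kernel

theorem checkAll_1 : checkAll 1 = true := by decide +kernel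

theorem checkAll_2 : checkAll 2 = true := by decide +kernel

theorem checkAll_3 : checkAll 3 = true := by decide +kernel

theorem checkAll_4 : checkAll 4 = true := by decide +kernel

theorem checkAll_5 : checkAll 5 = true := by decide +kernel

theorem checkAll_6 : checkAll 6 = true := by decide +kernel

theorem checkAll_7 : checkAll 7 = true := by decide +kernel

theorem checkAll_8 : checkAll 8 = true := by decide +kernel

theorem checkAll_9 : checkAll 9 = true := by decide +kernel

theorem checkAll_10 : checkAll 10 = true := by decide +kernel

theorem checkAll_11 : checkAll 11 = true := by decide +kernel

/-! ### Soundness of the elimination -/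

theorem forceNat_eq {α : Type} (n : ℕ) (k : ℕ → α) : forceNat n k = k n := by
  cases n <;> rfl

/-- The linear form with coefficients the `n` lowest digits of `N`, evaluated at `c`. -/
def phi : ℕ → ℕ → (ℕ → ZMod 127) → ZMod 127
  | 0, _, _ => 0
  | n + 1, N, c => ((N % 65536 : ℕ) : ZMod 127) * c 0 + phi n (N / 65536) (fun j => c (j + 1))

/-- The `n` lowest digits are at most 254. -/
def GoodRow : ℕ → ℕ → Prop
  | 0, _ => True
  | n + 1, N => N % 65536 ≤ 254 ∧ GoodRow n (N / 65536)

theorem fold1_mod (n N : ℕ) :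
    fold1 (maskNat 127 (n + 1)) (maskNat 511 (n + 1)) N % 65536
      = (N % 65536) % 128 + (N % 65536) / 128 ∧
    fold1 (maskNat 127 (n + 1)) (maskNat 511 (n + 1)) N / 65536
      = fold1 (maskNat 127 n) (maskNat 511 n) (N / 65536) := by
  have key : ∀ X v, v < 65536 →
      (X &&& maskNat v (n + 1)) % 65536 = (X % 65536) &&& v ∧
      (X &&& maskNat v (n + 1)) / 65536 = (X / 65536) &&& maskNat v n := by
    intro X v hv
    have h1 : maskNat v (n + 1) % 65536 = v := by simp only [maskNat]; omega
    have h2 : maskNat v (n + 1) / 65536 = maskNat v n := by simp only [maskNat]; omega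
    constructor
    · have := Nat.and_mod_two_pow (a := X) (b := maskNat v (n + 1)) (n := 16)
      norm_num at this
      rw [this, h1]
    · have := Nat.and_div_two_pow (a := X) (b := maskNat v (n + 1)) (n := 16)
      norm_num at this
      rw [this, h2]
  obtain ⟨a1, a2⟩ := key N 127 (by norm_num)
  obtain ⟨b1, b2⟩ := key (N / 128) 511 (by norm_num)
  have c1 : (N % 65536) &&& 127 = (N % 65536) % 128 := Nat.and_two_pow_sub_one_eq_mod _ 7
  have c2 : (N / 128 % 65536) &&& 511 = (N % 65536) / 128 := by
    rw [show 511 = 2 ^ 9 - 1 by norm_num, Nat.and_two_pow_sub_one_eq_mod]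
    omega
  have e1 : N / 128 / 65536 = N / 65536 / 128 := by omega
  rw [c1] at a1
  rw [c2] at b1
  rw [e1] at b2
  change ((N &&& maskNat 127 (n + 1)) + (N / 128 &&& maskNat 511 (n + 1))) % 65536 = _ ∧
    ((N &&& maskNat 127 (n + 1)) + (N / 128 &&& maskNat 511 (n + 1))) / 65536 =
      (N / 65536 &&& maskNat 127 n) + (N / 65536 / 128 &&& maskNat 511 n)
  rw [← a2, ← b2]
  omega

theorem cast_fold (v : ℕ) : ((v % 128 + v / 128 : ℕ) : ZMod 127) = (v : ZMod 127) := by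
  rw [ZMod.natCast_eq_natCast_iff]
  unfold Nat.ModEq
  omega

theorem phi_fold1 (n : ℕ) : ∀ (N : ℕ) (c : ℕ → ZMod 127),
    phi n (fold1 (maskNat 127 n) (maskNat 511 n) N) c = phi n N c := by
  induction n with
  | zero => intros; rfl
  | succ n ih =>
    intro N c
    obtain ⟨h1, h2⟩ := fold1_mod n N
    simp only [phi]
    rw [h1, h2, ih, cast_fold]

theorem goodRow_fold2 (n : ℕ) : ∀ N : ℕ,
    GoodRow n (fold1 (maskNat 127 n) (maskNat 511 n)
      (fold1 (maskNat 127 n) (maskNat 511 n) N)) := by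
  induction n with
  | zero => intros; trivial
  | succ n ih =>
    intro N
    obtain ⟨h1, h2⟩ := fold1_mod n N
    obtain ⟨h3, h4⟩ := fold1_mod n (fold1 (maskNat 127 (n + 1)) (maskNat 511 (n + 1)) N)
    refine ⟨?_, ?_⟩
    · rw [h3, h1]; omega
    · rw [h4, h2]; exact ih _

theorem phi_add_mul (n : ℕ) : ∀ (r q e : ℕ) (c : ℕ → ZMod 127), GoodRow n r → GoodRow n q →
    e ≤ 254 → phi n (r + e * q) c = phi n r c + e * phi n q c := by
  induction n with
  | zero => intros; simp [phi]
  | succ n ih =>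
    intro r q e c hr hq he
    obtain ⟨hr1, hr2⟩ := hr
    obtain ⟨hq1, hq2⟩ := hq
    have hm : e * (q % 65536) ≤ 254 * 254 := Nat.mul_le_mul he hq1
    have hs : e * q = e * (q % 65536) + 65536 * (e * (q / 65536)) := by
      conv_lhs => rw [← Nat.mod_add_div q 65536]
      ring
    have h1 : (r + e * q) % 65536 = r % 65536 + e * (q % 65536) := by rw [hs]; omega
    have h2 : (r + e * q) / 65536 = r / 65536 + e * (q / 65536) := by rw [hs]; omega
    simp only [phi]
    rw [h1, h2, ih _ _ _ _ hr2 hq2 he]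
    push_cast
    ring

theorem phi_zero (n : ℕ) : ∀ c : ℕ → ZMod 127, phi n 0 c = 0 := by
  induction n with
  | zero => intros; rfl
  | succ n ih => intro c; simp [phi, ih]

theorem goodRow_zero (n : ℕ) : GoodRow n 0 := by
  induction n with
  | zero => trivial
  | succ n ih => exact ⟨by norm_num, by simpa using ih⟩

theorem phi_mul (n r e : ℕ) (c : ℕ → ZMod 127) (hr : GoodRow n r) (he : e ≤ 254) :
    phi n (e * r) c = e * phi n r c := by
  have := phi_add_mul n 0 r e c (goodRow_zero n) hr he
  simpa [phi_zero] using this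

/-- The row operation of `stepAll`. -/
def stepRow (m1 m2 q r : ℕ) : ℕ := fold1 m1 m2 (fold1 m1 m2 (r + r % 65536 * q)) / 65536

theorem mem_stepAll (m1 m2 q : ℕ) (rows : List ℕ) : ∀ acc : List ℕ, ∀ s,
    s ∈ stepAll m1 m2 q rows acc → s ∈ acc ∨ ∃ r ∈ rows, s = stepRow m1 m2 q r := by
  induction rows with
  | nil => intro acc s hs; exact Or.inl hs
  | cons r rs ih =>
    intro acc s hs
    have e : stepAll m1 m2 q (r :: rs) acc = stepAll m1 m2 q rs (stepRow m1 m2 q r :: acc) := by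
      simp only [stepAll, forceNat_eq]
      rfl
    rw [e] at hs
    rcases ih _ _ hs with h | ⟨rb, h, hb⟩
    · rcases List.mem_cons.1 h with h | h
      · exact Or.inr ⟨r, by simp, h⟩
      · exact Or.inl h
    · exact Or.inr ⟨rb, by simp [h], hb⟩

theorem pickRow_spec (k : ℕ → List ℕ → Bool) (rows : List ℕ) : ∀ acc : List ℕ,
    pickRow k rows acc = true → ∃ r rest, k r rest = true ∧ (r ∈ acc ∨ r ∈ rows) ∧
      ∀ s ∈ rest, s ∈ acc ∨ s ∈ rows := by
  induction rows with
  | nil => intro acc h; exact absurd h (by simp [pickRow])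
  | cons r rs ih =>
    intro acc h
    change Bool.rec (motive := fun _ => Bool) (k r (acc ++ rs)) (pickRow k rs (r :: acc))
      (Nat.beq (r % 65536 % 127) 0) = true at h
    cases hb : Nat.beq (r % 65536 % 127) 0 with
    | false =>
      rw [hb] at h
      refine ⟨r, acc ++ rs, h, by simp, ?_⟩
      intro s hs
      rcases List.mem_append.1 hs with h | h
      · exact Or.inl h
      · exact Or.inr (by simp [h])
    | true =>
      rw [hb] at h
      obtain ⟨rb, rest, h1, h2, h3⟩ := ih _ h
      refine ⟨rb, rest, h1, ?_, ?_⟩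
      · simp only [List.mem_cons] at h2 ⊢; tauto
      · intro s hs
        have := h3 s hs
        simp only [List.mem_cons] at this ⊢; tauto

theorem elimRows_succ (n m1 m2 : ℕ) (rows : List ℕ) : elimRows (n + 1) m1 m2 rows =
      pickRow (fun r rest =>
        forceNat (Nat.mul (Nat.mod (Nat.pow (Nat.sub 254 (Nat.mod r 65536)) 125) 127) r) fun v =>
        forceNat (fold1 m1 m2 v) fun v =>
        forceNat (fold1 m1 m2 v) fun q =>
        Bool.rec (motive := fun _ => Bool) false
          (forceNat (Nat.div m1 65536) fun m1b => forceNat (Nat.div m2 65536) fun m2b =>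
            elimRows n m1b m2b (stepAll m1 m2 q rest List.nil))
          (Nat.beq (Nat.mod (Nat.succ (Nat.mod q 65536)) 127) 0)) rows List.nil := rfl

theorem elimRows_sound (n : ℕ) : ∀ (rows : List ℕ),
    elimRows n (maskNat 127 n) (maskNat 511 n) rows = true →
    (∀ r ∈ rows, GoodRow n r) → ∀ c : ℕ → ZMod 127,
    (∀ r ∈ rows, phi n r c = 0) → ∀ j < n, c j = 0 := by
  induction n with
  | zero => intro _ _ _ c _ j hj; omega
  | succ n ih =>
    intro rows h hg c hc
    rw [elimRows_succ] at h
    obtain ⟨r, rest, h1, h2, h3⟩ := pickRow_spec _ _ _ h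
    simp only [List.not_mem_nil, false_or] at h2 h3
    simp only [forceNat_eq] at h1
    set m1 := maskNat 127 (n + 1) with hm1
    set m2 := maskNat 511 (n + 1) with hm2
    set t : ℕ := Nat.mod (Nat.pow (Nat.sub 254 (Nat.mod r 65536)) 125) 127 with ht
    have htb : t ≤ 254 := by
      have : t < 127 := Nat.mod_lt _ (by norm_num)
      omega
    set q := fold1 m1 m2 (fold1 m1 m2 (Nat.mul t r)) with hq
    have hqg : GoodRow (n + 1) q := goodRow_fold2 _ _
    have hq0 : phi (n + 1) q c = 0 := by
      rw [hq, hm1, hm2, phi_fold1, phi_fold1]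
      change phi (n + 1) (t * r) c = 0
      rw [phi_mul _ _ _ _ (hg r h2) htb, hc r h2, mul_zero]
    cases hb : Nat.beq (Nat.mod (Nat.succ (Nat.mod q 65536)) 127) 0 with
    | false => rw [hb] at h1; exact absurd h1 (by simp)
    | true =>
      rw [hb] at h1
      have hlow : ((q % 65536 : ℕ) : ZMod 127) = -1 := by
        have h4 : (q % 65536 + 1) % 127 = 0 := Nat.eq_of_beq_eq_true hb
        have h5 : ((q % 65536 + 1 : ℕ) : ZMod 127) = 0 :=
          (ZMod.natCast_eq_zero_iff _ _).2 (Nat.dvd_of_mod_eq_zero h4)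
        push_cast at h5 ⊢
        exact eq_neg_of_add_eq_zero_left h5
      have hd1 : m1 / 65536 = maskNat 127 n := by rw [hm1]; simp only [maskNat]; omega
      have hd2 : m2 / 65536 = maskNat 511 n := by rw [hm2]; simp only [maskNat]; omega
      change elimRows n (m1 / 65536) (m2 / 65536) (stepAll m1 m2 q rest []) = true at h1
      rw [hd1, hd2] at h1
      have key : ∀ s ∈ stepAll m1 m2 q rest [], GoodRow n s ∧
          phi n s (fun j => c (j + 1)) = 0 := by
        intro s hs
        rcases mem_stepAll _ _ _ _ _ _ hs with hs | ⟨rb, hrb, rfl⟩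
        · simp at hs
        have hrbg := hg rb (h3 rb hrb)
        have hrb0 := hc rb (h3 rb hrb)
        set w := fold1 m1 m2 (fold1 m1 m2 (rb + rb % 65536 * q)) with hw
        have hwg : GoodRow (n + 1) w := goodRow_fold2 _ _
        have hph : ∀ cb, phi (n + 1) w cb =
            phi (n + 1) rb cb + (rb % 65536 : ℕ) * phi (n + 1) q cb := by
          intro cb
          rw [hw, hm1, hm2, phi_fold1, phi_fold1, phi_add_mul _ _ _ _ _ hrbg hqg hrbg.1]
        refine ⟨hwg.2, ?_⟩
        have hw0 : ((w % 65536 : ℕ) : ZMod 127) = 0 := by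
          have hz : ∀ N, phi (n + 1) N (fun j => if j = 0 then 1 else 0)
              = ((N % 65536 : ℕ) : ZMod 127) := by
            intro N
            have : ∀ m M, phi m M (fun _ => 0) = 0 := by
              intro m
              induction m with
              | zero => intro M; rfl
              | succ m ihm => intro M; simp [phi, ihm]
            simp [phi, this]
          have := hph (fun j => if j = 0 then 1 else 0)
          rw [hz, hz, hz, hlow] at this
          rw [this]; ring
        have := hph c
        rw [hrb0, hq0] at this
        simp only [phi] at this
        rw [hw0] at this
        simpa [stepRow] using this
      have hrec := ih _ h1 (fun s hs => (key s hs).1) (fun j => c (j + 1))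
        (fun s hs => (key s hs).2)
      intro j hj
      cases j with
      | succ j => exact hrec j (by omega)
      | zero =>
        have hzz : ∀ (m M : ℕ) (cb : ℕ → ZMod 127), (∀ j < m, cb j = 0) → phi m M cb = 0 := by
          intro m
          induction m with
          | zero => intros; rfl
          | succ m ihm =>
            intro M cb hcb
            simp only [phi]
            rw [hcb 0 (by omega), ihm _ _ (fun j hj => hcb (j + 1) (by omega))]
            simp
        simp only [phi] at hq0
        rw [hzz _ _ _ hrec, hlow] at hq0
        simpa using hq0

/-! ### The interpolation matrix -/

theorem forceTriples_eq {α : Type} (k : List (ℕ × ℕ × ℕ) → α) (l : List (ℕ × ℕ × ℕ)) :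
    ∀ acc, forceTriples k l acc = k (l.reverse ++ acc) := by
  induction l with
  | nil => intro acc; rfl
  | cons e l ih =>
    intro acc
    have : forceTriples k (e :: l) acc = forceTriples k l (e :: acc) := by
      simp only [forceTriples, forceNat_eq]
    rw [this, ih]
    simp

theorem withRows_eq {α : Type} (E : List (ℕ × ℕ × ℕ)) (P : ℕ × ℕ × ℕ) (k : List ℕ → α)
    (ns : List (ℕ × ℕ × ℕ)) : ∀ acc, withRows E P k ns acc =
      k ((ns.map fun ν => rowNat P.1 P.2.1 P.2.2 ν.1 ν.2.1 ν.2.2 E).reverse ++ acc) := by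
  induction ns with
  | nil => intro acc; rfl
  | cons e l ih =>
    intro acc
    have : withRows E P k (e :: l) acc =
        withRows E P k l (rowNat P.1 P.2.1 P.2.2 e.1 e.2.1 e.2.2 E :: acc) := by
      simp only [withRows, forceNat_eq]
    rw [this, ih]
    simp

theorem withRowsAll_eq {α : Type} (E ns : List (ℕ × ℕ × ℕ)) (k : List (List ℕ) → α)
    (ps : List (ℕ × ℕ × ℕ)) : ∀ acc, withRowsAll E ns k ps acc =
      k ((ps.map fun P =>
        (ns.map fun ν => rowNat P.1 P.2.1 P.2.2 ν.1 ν.2.1 ν.2.2 E).reverse).reverse ++ acc) := by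
  induction ps with
  | nil => intro acc; rfl
  | cons P l ih =>
    intro acc
    have : withRowsAll E ns k (P :: l) acc = withRows E P
        (fun r => withRowsAll E ns k l (r :: acc)) ns [] := rfl
    rw [this, withRows_eq, ih]
    simp

/-- Entry of the interpolation matrix. -/
def entryNat (P ν e : ℕ × ℕ × ℕ) : ℕ :=
  gEntry P.1 ν.1 e.1 * (gEntry P.2.1 ν.2.1 e.2.1 * gEntry P.2.2 ν.2.2 e.2.2)

theorem rowNat_cons (P ν e : ℕ × ℕ × ℕ) (E : List (ℕ × ℕ × ℕ)) :
    rowNat P.1 P.2.1 P.2.2 ν.1 ν.2.1 ν.2.2 (e :: E) =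
      entryNat P ν e % 127 + 65536 * rowNat P.1 P.2.1 P.2.2 ν.1 ν.2.1 ν.2.2 E := rfl

theorem goodRow_rowNat (P ν : ℕ × ℕ × ℕ) (E : List (ℕ × ℕ × ℕ)) :
    GoodRow E.length (rowNat P.1 P.2.1 P.2.2 ν.1 ν.2.1 ν.2.2 E) := by
  induction E with
  | nil => trivial
  | cons e E ih =>
    rw [rowNat_cons]
    refine ⟨by omega, ?_⟩
    have : (entryNat P ν e % 127 + 65536 * rowNat P.1 P.2.1 P.2.2 ν.1 ν.2.1 ν.2.2 E) / 65536
      = rowNat P.1 P.2.1 P.2.2 ν.1 ν.2.1 ν.2.2 E := by omega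
    rw [this]
    exact ih

theorem phi_rowNat (P ν : ℕ × ℕ × ℕ) (C : ℕ × ℕ × ℕ → ZMod 127) (E : List (ℕ × ℕ × ℕ)) :
    ∀ c : ℕ → ZMod 127, (∀ j (h : j < E.length), c j = C E[j]) →
    phi E.length (rowNat P.1 P.2.1 P.2.2 ν.1 ν.2.1 ν.2.2 E) c =
      (E.map fun e => (entryNat P ν e : ZMod 127) * C e).sum := by
  induction E with
  | nil => intros; rfl
  | cons e E ih =>
    intro c hc
    rw [rowNat_cons]
    simp only [List.length_cons, phi, List.map_cons, List.sum_cons]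
    have h1 : (entryNat P ν e % 127 + 65536 * rowNat P.1 P.2.1 P.2.2 ν.1 ν.2.1 ν.2.2 E) / 65536
      = rowNat P.1 P.2.1 P.2.2 ν.1 ν.2.1 ν.2.2 E := by omega
    have h2 : (entryNat P ν e % 127 + 65536 * rowNat P.1 P.2.1 P.2.2 ν.1 ν.2.1 ν.2.2 E) % 65536
      = entryNat P ν e % 127 := by omega
    rw [h1, h2, ih _ (fun j hj => hc (j + 1) (Nat.succ_lt_succ hj)),
      hc 0 (by simp), ZMod.natCast_mod]
    rfl

attribute [irreducible] GoodRow phi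

theorem expList_length : expList.length = 220 := by decide +kernel

theorem expList_nodup : expList.Nodup := by decide +kernel

theorem ptList_nodup : ptList.Nodup := by decide +kernel

theorem mem_expList (e : ℕ × ℕ × ℕ) : e ∈ expList ↔ e.1 + e.2.1 + e.2.2 ≤ 9 := by
  obtain ⟨i, j, k⟩ := e
  simp only [expList, List.mem_flatMap, List.mem_range, List.mem_map, Prod.mk.injEq]
  constructor
  · rintro ⟨ib, h1, jb, h2, kb, h3, rfl, rfl, rfl⟩; omega
  · intro h; exact ⟨i, by omega, j, by omega, k, by omega, rfl, rfl, rfl⟩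

theorem mem_nuList (m : ℕ) (e : ℕ × ℕ × ℕ) (h : e ∈ nuList m) : e.1 + e.2.1 + e.2.2 < m := by
  obtain ⟨i, j, k⟩ := e
  simp only [nuList, List.mem_flatMap, List.mem_range, List.mem_map, Prod.mk.injEq] at h
  obtain ⟨ib, h1, jb, h2, kb, h3, rfl, rfl, rfl⟩ := h
  simp only
  omega

/-- Nonsingularity mod 127. -/
theorem checkAll_sound (a : ℕ) (h : checkAll a = true) (C : ℕ × ℕ × ℕ → ZMod 127)
    (h4 : ∀ P ∈ ptList.take a, ∀ ν ∈ nuList 4,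
      ∑ e ∈ expList.toFinset, (entryNat P ν e : ZMod 127) * C e = 0)
    (h3 : ∀ P ∈ (ptList.drop a).take (22 - 2 * a), ∀ ν ∈ nuList 3,
      ∑ e ∈ expList.toFinset, (entryNat P ν e : ZMod 127) * C e = 0) :
    ∀ e ∈ expList, C e = 0 := by
  unfold checkAll at h
  rw [forceNat_eq, forceNat_eq, forceTriples_eq, forceTriples_eq, forceTriples_eq,
    withRowsAll_eq, withRowsAll_eq] at h
  simp only [List.append_nil] at h
  have hlen : expList.reverse.length = 220 := by rw [List.length_reverse, expList_length]
  have hrows : ∀ P ν, ∑ e ∈ expList.toFinset, (entryNat P ν e : ZMod 127) * C e = 0 →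
      GoodRow 220 (rowNat P.1 P.2.1 P.2.2 ν.1 ν.2.1 ν.2.2 expList.reverse) ∧
      phi 220 (rowNat P.1 P.2.1 P.2.2 ν.1 ν.2.1 ν.2.2 expList.reverse)
        (fun j => C (expList.reverse.getD j (0, 0, 0))) = 0 := by
    intro P ν hP
    have hgood := goodRow_rowNat P ν expList.reverse
    rw [hlen] at hgood
    refine ⟨hgood, ?_⟩
    have := phi_rowNat P ν C expList.reverse (fun j => C (expList.reverse.getD j (0, 0, 0)))
      (fun j hj => by simp only [List.getD_eq_getElem _ _ hj])
    rw [hlen] at this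
    rw [this, List.map_reverse, List.sum_reverse, ← hP, List.sum_toFinset _ expList_nodup]
  have hmem : ∀ r ∈ (((ptList.take a).map fun P => ((nuList 4).reverse.map fun ν =>
        rowNat P.1 P.2.1 P.2.2 ν.1 ν.2.1 ν.2.2 expList.reverse).reverse).reverse.flatten ++
      ((((ptList.drop a).take (22 - 2 * a)).map fun P => ((nuList 3).reverse.map fun ν =>
        rowNat P.1 P.2.1 P.2.2 ν.1 ν.2.1 ν.2.2 expList.reverse).reverse).reverse).flatten),
      GoodRow 220 r ∧ phi 220 r (fun j => C (expList.reverse.getD j (0, 0, 0))) = 0 := by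
    intro r hr
    simp only [List.mem_append, List.mem_flatten, List.mem_reverse, List.mem_map] at hr
    rcases hr with ⟨l, ⟨P, hP, rfl⟩, hr⟩ | ⟨l, ⟨P, hP, rfl⟩, hr⟩
    · simp only [List.mem_reverse, List.mem_map] at hr
      obtain ⟨ν, hν, rfl⟩ := hr
      exact hrows P ν (h4 P hP ν hν)
    · simp only [List.mem_reverse, List.mem_map] at hr
      obtain ⟨ν, hν, rfl⟩ := hr
      exact hrows P ν (h3 P hP ν hν)
  have := elimRows_sound 220 _ h (fun r hr => (hmem r hr).1) _ (fun r hr => (hmem r hr).2)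
  intro e he
  obtain ⟨j, hj, rfl⟩ := List.mem_iff_getElem.1 (List.mem_reverse.2 he)
  have hb := this j (by rw [hlen] at hj; exact hj)
  simpa only [List.getD_eq_getElem _ _ hj] using hb

/-- Nonsingularity mod 127 implies nonsingularity over `ℚ`. -/
theorem lift_rat {ι κ : Type} [DecidableEq ι] (S : Finset ι) (K : Set κ) (M : κ → ι → ℕ)
    (h : ∀ C : ι → ZMod 127, (∀ k ∈ K, ∑ e ∈ S, (M k e : ZMod 127) * C e = 0) → ∀ e ∈ S, C e = 0)
    (C : ι → ℚ) (hC : ∀ k ∈ K, ∑ e ∈ S, (M k e : ℚ) * C e = 0) : ∀ e ∈ S, C e = 0 := by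
  by_contra! hne
  obtain ⟨e0, he0, hne⟩ := hne
  obtain ⟨b, hb⟩ := IsLocalization.exist_integer_multiples_of_finset (nonZeroDivisors ℤ)
    (S.image C)
  have hb0 : ((b : ℤ) : ℚ) ≠ 0 := by
    have := nonZeroDivisors.coe_ne_zero b
    exact_mod_cast this
  have hz : ∀ e, ∃ z : ℤ, e ∈ S → (z : ℚ) = (b : ℤ) * C e := by
    intro e
    by_cases he : e ∈ S
    · obtain ⟨z, hz⟩ := hb (C e) (Finset.mem_image_of_mem _ he)
      refine ⟨z, fun _ => ?_⟩
      simpa using hz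
    · exact ⟨0, fun h => absurd h he⟩
  choose z hz using hz
  obtain ⟨w, hw, hg⟩ := Finset.extract_gcd z ⟨e0, he0⟩
  have hg0 : S.gcd z ≠ 0 := by
    intro h0
    have := hz e0 he0
    rw [hw e0 he0, h0] at this
    simp only [zero_mul, Int.cast_zero] at this
    exact hne ((mul_eq_zero.1 this.symm).resolve_left hb0)
  have hw0 : ∀ k ∈ K, ∑ e ∈ S, (M k e : ℤ) * w e = 0 := by
    intro k hk
    have h1 : (((S.gcd z) * ∑ e ∈ S, (M k e : ℤ) * w e : ℤ) : ℚ) = 0 := by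
      have h2 : (S.gcd z) * ∑ e ∈ S, (M k e : ℤ) * w e = ∑ e ∈ S, (M k e : ℤ) * z e := by
        rw [Finset.mul_sum]
        refine Finset.sum_congr rfl fun e he => ?_
        conv_rhs => rw [hw e he]
        ring
      rw [h2]
      push_cast
      have h3 : ∑ e ∈ S, (M k e : ℚ) * (z e : ℚ) = (b : ℤ) * ∑ e ∈ S, (M k e : ℚ) * C e := by
        rw [Finset.mul_sum]
        refine Finset.sum_congr rfl fun e he => ?_
        rw [hz e he]
        ring
      rw [h3, hC k hk, mul_zero]
    have h4 : (S.gcd z) * ∑ e ∈ S, (M k e : ℤ) * w e = 0 := by exact_mod_cast h1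
    exact (mul_eq_zero.1 h4).resolve_left hg0
  have hall := h (fun e => ((w e : ℤ) : ZMod 127)) (by
    intro k hk
    have := congrArg (fun x : ℤ => (x : ZMod 127)) (hw0 k hk)
    simpa using this)
  have hdvd : (127 : ℤ) ∣ S.gcd w := Finset.dvd_gcd fun e he =>
    (ZMod.intCast_zmod_eq_zero_iff_dvd (w e) 127).1 (hall e he)
  rw [hg] at hdvd
  norm_num at hdvd

/-! ### Polynomials -/

theorem descFac_eq (e i : ℕ) : descFac e i = e.descFactorial i := by
  induction i with
  | zero => rfl
  | succ i ih =>
    rw [Nat.descFactorial_succ, ← ih]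
    rfl

theorem pderiv_pow_monomial (i : Fin 4) (k : ℕ) (d : Fin 4 →₀ ℕ) (r : ℚ) :
    ((pderiv i).toLinearMap ^ k : Module.End ℚ (MvPolynomial (Fin 4) ℚ)) (monomial d r) =
      monomial (d - Finsupp.single i k) (r * (d i).descFactorial k) := by
  induction k with
  | zero => simp
  | succ k ih =>
    rw [pow_succ', Module.End.mul_apply, ih]
    change pderiv i (monomial _ _) = _
    rw [pderiv_monomial, tsub_tsub, ← Finsupp.single_add]
    congr 1
    simp only [Finsupp.coe_tsub, Pi.sub_apply, Finsupp.single_eq_same, Nat.descFactorial_succ]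
    push_cast
    ring

/-- The exponent of the monomial of degree 9 with exponents `e` of `x₁, x₂, x₃`. -/
noncomputable def toExp (e : ℕ × ℕ × ℕ) : Fin 4 →₀ ℕ :=
  Finsupp.equivFunOnFinite.symm ![9 - e.1 - e.2.1 - e.2.2, e.1, e.2.1, e.2.2]

/-- A point with affine coordinates `P`. -/
def toPt (P : ℕ × ℕ × ℕ) : Fin 4 → ℚ := ![1, P.1, P.2.1, P.2.2]

theorem toExp_apply (e : ℕ × ℕ × ℕ) : toExp e 0 = 9 - e.1 - e.2.1 - e.2.2 ∧ toExp e 1 = e.1 ∧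
    toExp e 2 = e.2.1 ∧ toExp e 3 = e.2.2 := ⟨rfl, rfl, rfl, rfl⟩

theorem eval_diffOp (P ν e : ℕ × ℕ × ℕ) (r : ℚ) :
    aeval (toPt P) (diffOp ![0, ν.1, ν.2.1, ν.2.2] (monomial (toExp e) r)) =
      (entryNat P ν e : ℚ) * r := by
  simp only [diffOp, Module.End.mul_apply]
  rw [pderiv_pow_monomial, pderiv_pow_monomial, pderiv_pow_monomial, pderiv_pow_monomial,
    aeval_monomial, Finsupp.prod_fintype _ _ (by simp)]
  simp only [Fin.prod_univ_four]
  obtain ⟨-, t1, t2, t3⟩ := toExp_apply e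
  simp [t1, t2, t3, toPt, entryNat, gEntry, descFac_eq]
  ring

theorem homog_eq_sum (f : MvPolynomial (Fin 4) ℚ) (hf : f.IsHomogeneous 9) :
    f = ∑ e ∈ expList.toFinset, monomial (toExp e) (coeff (toExp e) f) := by
  ext d
  rw [coeff_sum]
  simp only [coeff_monomial]
  by_cases hd : coeff d f = 0
  · rw [hd]
    symm
    refine Finset.sum_eq_zero fun e _ => ?_
    split_ifs with h
    · rw [h, hd]
    · rfl
  · have hdeg : d 0 + d 1 + d 2 + d 3 = 9 := by
      have := hf hd
      rw [Finsupp.weight_apply, Finsupp.sum_fintype _ _ (by simp)] at this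
      simpa [Fin.sum_univ_four] using this
    have hde : toExp (d 1, d 2, d 3) = d := by
      ext i
      fin_cases i <;> simp [toExp]
      omega
    rw [Finset.sum_eq_single (d 1, d 2, d 3)]
    · rw [hde]; simp
    · intro e _ hne
      rw [if_neg]
      intro h
      apply hne
      rw [← h]
      simp [toExp]
    · intro h
      exfalso
      apply h
      rw [List.mem_toFinset, mem_expList]
      simp only
      omega

theorem cond_of_vanishing (f : MvPolynomial (Fin 4) ℚ) (hf : f.IsHomogeneous 9) (m : ℕ)
    (P ν : ℕ × ℕ × ℕ) (hν : ν ∈ nuList m) (hv : f ∈ vanishingSpace m (toPt P)) :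
    ∑ e ∈ expList.toFinset, (entryNat P ν e : ℚ) * coeff (toExp e) f = 0 := by
  simp only [vanishingSpace, Submodule.mem_iInf, LinearMap.mem_ker] at hv
  have h1 := hv ![0, ν.1, ν.2.1, ν.2.2] (by
    have := mem_nuList m ν hν
    simp [Fin.sum_univ_four]
    omega)
  rw [LinearMap.comp_apply] at h1
  rw [homog_eq_sum f hf, map_sum, map_sum] at h1
  rw [← h1]
  refine Finset.sum_congr rfl fun e _ => ?_
  exact (eval_diffOp P ν e _).symm

theorem system_bot (a : ℕ) (hcheck : checkAll a = true)
    (f : MvPolynomial (Fin 4) ℚ) (hf : f.IsHomogeneous 9)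
    (h4 : ∀ P ∈ ptList.take a, f ∈ vanishingSpace 4 (toPt P))
    (h3 : ∀ P ∈ (ptList.drop a).take (22 - 2 * a), f ∈ vanishingSpace 3 (toPt P)) : f = 0 := by
  have key := lift_rat expList.toFinset
    {k : (ℕ × ℕ × ℕ) × (ℕ × ℕ × ℕ) | (k.1 ∈ ptList.take a ∧ k.2 ∈ nuList 4) ∨
      (k.1 ∈ (ptList.drop a).take (22 - 2 * a) ∧ k.2 ∈ nuList 3)}
    (fun k e => entryNat k.1 k.2 e)
    (fun C hC e he => checkAll_sound a hcheck C
      (fun P hP ν hν => hC (P, ν) (Or.inl ⟨hP, hν⟩))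
      (fun P hP ν hν => hC (P, ν) (Or.inr ⟨hP, hν⟩)) e (List.mem_toFinset.1 he))
    (fun e => coeff (toExp e) f)
    (by
      rintro ⟨P, ν⟩ (⟨hP, hν⟩ | ⟨hP, hν⟩)
      · exact cond_of_vanishing f hf 4 P ν hν (h4 P hP)
      · exact cond_of_vanishing f hf 3 P ν hν (h3 P hP))
  rw [homog_eq_sum f hf]
  refine Finset.sum_eq_zero fun e he => ?_
  rw [key e he, monomial_zero]

theorem toPt_indep (P Q : ℕ × ℕ × ℕ) (h : P ≠ Q) : LinearIndependent ℚ ![toPt P, toPt Q] := by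
  rw [LinearIndependent.pair_iff]
  intro s t hst
  have h0 := congrFun hst 0
  have h1 := congrFun hst 1
  have h2 := congrFun hst 2
  have h3 := congrFun hst 3
  simp [toPt] at h0 h1 h2 h3
  have ht : t = -s := by linarith
  subst ht
  by_cases hs : s = 0
  · simp [hs]
  · exfalso
    apply h
    have e : ∀ x y : ℕ, s * x + -(s * y) = 0 → x = y := by
      intro x y hxy
      have : s * ((x : ℚ) - y) = 0 := by linarith
      have := (mul_eq_zero.1 this).resolve_left hs
      exact_mod_cast sub_eq_zero.1 this
    refine Prod.ext (e _ _ (by linarith)) (Prod.ext (e _ _ (by linarith)) (e _ _ (by linarith)))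

theorem main_case (a b : ℕ) (hab : 2 * a + b = 22) (hcheck : checkAll a = true) :
    nonSpecial 9 (List.replicate a 4 ++ List.replicate b 3) ∧
      vdim 9 (List.replicate a 4 ++ List.replicate b 3) = -1 := by
  have hv : vdim 9 (List.replicate a 4 ++ List.replicate b 3) = -1 := by
    have c1 : Nat.choose 12 3 = 220 := by decide
    have c2 : Nat.choose 6 3 = 20 := by decide
    have c3 : Nat.choose 5 3 = 10 := by decide
    simp only [vdim, List.map_append, List.map_replicate, List.sum_append, List.sum_replicate]
    norm_num [c1, c2, c3]
    omega
  refine ⟨?_, hv⟩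
  have hlen : (List.replicate a 4 ++ List.replicate b 3).length = a + b := by simp
  have hpl : ptList.length = 22 := rfl
  refine ⟨fun i => toPt (ptList.getD i (0, 0, 0)), ?_, ?_, ?_⟩
  · intro i h
    have := congrFun h 0
    simp [toPt] at this
  · intro i j hij
    apply toPt_indep
    have hi : (i : ℕ) < ptList.length := by have := i.2; omega
    have hj : (j : ℕ) < ptList.length := by have := j.2; omega
    rw [List.getD_eq_getElem _ _ hi, List.getD_eq_getElem _ _ hj]
    intro h
    exact hij (Fin.ext ((List.Nodup.getElem_inj_iff ptList_nodup).1 h))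
  · rw [hv]
    have hbot : systemSpace 9 (List.replicate a 4 ++ List.replicate b 3)
        (fun i => toPt (ptList.getD i (0, 0, 0))) = ⊥ := by
      rw [Submodule.eq_bot_iff]
      intro f hf
      rw [systemSpace, Submodule.mem_inf, Submodule.mem_iInf] at hf
      obtain ⟨hhom, hvan⟩ := hf
      refine system_bot a hcheck f ((mem_homogeneousSubmodule _ _).1 hhom) ?_ ?_
      · intro P hP
        obtain ⟨i, hi, rfl⟩ := List.mem_iff_getElem.1 hP
        rw [List.length_take, hpl] at hi
        have := hvan ⟨i, by omega⟩
        simp only [List.get_eq_getElem] at this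
        rw [List.getElem_append_left (by simp; omega), List.getElem_replicate,
          List.getD_eq_getElem _ _ (by omega)] at this
        rw [List.getElem_take]
        exact this
      · intro P hP
        obtain ⟨i, hi, rfl⟩ := List.mem_iff_getElem.1 hP
        rw [List.length_take, List.length_drop, hpl] at hi
        have := hvan ⟨a + i, by omega⟩
        simp only [List.get_eq_getElem] at this
        rw [List.getElem_append_right (by simp), List.getElem_replicate,
          List.getD_eq_getElem _ _ (by omega)] at this
        rw [List.getElem_take, List.getElem_drop]
        exact this
    rw [hbot]
    simp

/-- `L_3(9; 4^{×a}, 3^{×b})` with `2a + b = 22` is non-special of virtual dimension `−1`. -/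
theorem nonSpecial_nine (a b : ℕ) (hab : 2 * a + b = 22) :
    nonSpecial 9 (List.replicate a 4 ++ List.replicate b 3) ∧
      vdim 9 (List.replicate a 4 ++ List.replicate b 3) = -1 := by
  have ha : a < 12 := by omega
  apply main_case a b hab
  interval_cases a
  · exact checkAll_0
  · exact checkAll_1
  · exact checkAll_2
  · exact checkAll_3
  · exact checkAll_4
  · exact checkAll_5
  · exact checkAll_6
  · exact checkAll_7
  · exact checkAll_8
  · exact checkAll_9
  · exact checkAll_10
  · exact checkAll_11
end

section
/- (Glueing 2^{×5} → 4.) Let d ≥ 0 and m_1,...,m_r be non-negative integers. If the system L_3(d; m_1,...,m_r, 4) is non-special, then the system L_3(d; m_1,...,m_r, 2^{×5}) is non-special. (The virtual dimensions of the two systems agree, since 5·C(2+2,3) = 20 = C(4+2,3).) -/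
open MvPolynomial

/-! ### Vanishing conditions, inductively -/

lemma gl_pderiv_commute (i j : Fin 4) :
    Commute ((pderiv i).toLinearMap : Module.End ℚ (MvPolynomial (Fin 4) ℚ))
      (pderiv j).toLinearMap := by
  have h : ⁅pderiv (R := ℚ) i, pderiv (R := ℚ) j⁆ = 0 := by
    apply MvPolynomial.derivation_ext
    intro k
    simp [Derivation.commutator_apply, pderiv_X, Pi.single_apply]
    split_ifs <;> simp
  apply LinearMap.ext
  intro f
  have := congrArg (fun D => D f) h
  simp only [Derivation.commutator_apply, Derivation.zero_apply] at this
  exact sub_eq_zero.mp this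

lemma gl_mem_van (m : ℕ) (p : Fin 4 → ℚ) (f : MvPolynomial (Fin 4) ℚ) :
    f ∈ vanishingSpace m p ↔ ∀ ν : Fin 4 → ℕ, ∑ j, ν j < m → eval p (diffOp ν f) = 0 := by
  simp [vanishingSpace, Submodule.mem_iInf, aeval_eq_eval]

lemma gl_diffOp_peel (ν : Fin 4 → ℕ) (i : Fin 4) (f : MvPolynomial (Fin 4) ℚ) :
    diffOp (ν + Pi.single i 1) f = diffOp ν (pderiv i f) := by
  have key : diffOp (ν + Pi.single i 1) = diffOp ν * (pderiv i).toLinearMap := by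
    have c := gl_pderiv_commute
    fin_cases i
    · simp only [diffOp, Pi.add_apply, Fin.zero_eta, Fin.isValue, Pi.single_eq_same, pow_succ]
      simp only [mul_assoc]
      simp [← mul_assoc]
      simp [mul_assoc, ((c 0 3).pow_right (ν 3)).eq, ((c 0 2).pow_right (ν 2)).left_comm,
        ((c 0 1).pow_right (ν 1)).left_comm]
    · simp only [diffOp, Pi.add_apply, Fin.mk_one, Fin.isValue, Pi.single_eq_same, pow_succ]
      simp [mul_assoc, ((c 1 3).pow_right (ν 3)).eq, ((c 1 2).pow_right (ν 2)).left_comm]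
    · simp only [diffOp, Pi.add_apply, Fin.reduceFinMk, Fin.isValue, Pi.single_eq_same, pow_succ]
      simp [mul_assoc, ((c 2 3).pow_right (ν 3)).eq]
    · simp only [diffOp, Pi.add_apply, Fin.reduceFinMk, Fin.isValue, Pi.single_eq_same, pow_succ]
      simp [mul_assoc]
  rw [key]; rfl

lemma gl_van_succ (m : ℕ) (p : Fin 4 → ℚ) (f : MvPolynomial (Fin 4) ℚ)
    (h0 : eval p f = 0) (h1 : ∀ i, pderiv i f ∈ vanishingSpace m p) :
    f ∈ vanishingSpace (m + 1) p := by
  rw [gl_mem_van]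
  intro ν hν
  by_cases hz : ν = 0
  · subst hz
    simpa [diffOp] using h0
  · obtain ⟨i, hi⟩ : ∃ i, ν i ≠ 0 := by
      by_contra hcon
      push Not at hcon
      exact hz (funext hcon)
    have hle : ν = (ν - Pi.single i 1) + Pi.single i 1 := by
      funext j
      by_cases hj : j = i
      · subst hj; simp; omega
      · simp [hj]
    have hs : ∑ j, ν j = ∑ j, (ν - Pi.single i 1 : Fin 4 → ℕ) j + 1 := by
      conv_lhs => rw [hle]
      simp [Finset.sum_add_distrib]
    rw [hle, gl_diffOp_peel]
    exact (gl_mem_van _ _ _).1 (h1 i) _ (by omega)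

lemma gl_van_two (p : Fin 4 → ℚ) (f : MvPolynomial (Fin 4) ℚ) (h : f ∈ vanishingSpace 2 p) :
    eval p f = 0 ∧ ∀ i, eval p (pderiv i f) = 0 := by
  rw [gl_mem_van] at h
  refine ⟨by simpa [diffOp] using h 0 (by simp), fun i => ?_⟩
  have := h (0 + Pi.single i 1) (by simp)
  rw [gl_diffOp_peel] at this
  simpa [diffOp] using this

/-! ### The affine chart at a point -/

/-- Restriction to the affine chart around `p` complementary to the coordinate `i₀`. -/
noncomputable def glChart (i₀ : Fin 4) (p : Fin 4 → ℚ) :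
    MvPolynomial (Fin 4) ℚ →ₐ[ℚ] MvPolynomial (Fin 3) ℚ :=
  aeval (fun i => C (p i) + i₀.insertNth (α := fun _ => MvPolynomial (Fin 3) ℚ) 0 X i)

lemma gl_chart_pderiv (i₀ : Fin 4) (p : Fin 4 → ℚ) (j : Fin 3) (f : MvPolynomial (Fin 4) ℚ) :
    pderiv j (glChart i₀ p f) = glChart i₀ p (pderiv (i₀.succAbove j) f) := by
  induction f using MvPolynomial.induction_on with
  | C a => simp [glChart]
  | add f g hf hg => simp [hf, hg]
  | mul_X f i hf =>
    simp only [map_mul, pderiv_mul, hf, map_add]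
    congr 2
    rcases Fin.eq_self_or_eq_succAbove i₀ i with rfl | ⟨k, rfl⟩
    · simp [glChart, pderiv_X]
    · by_cases hk : k = j
      · subst hk; simp [glChart]
      · have : i₀.succAbove k ≠ i₀.succAbove j := fun h => hk (Fin.succAbove_right_injective h)
        simp [glChart, pderiv_X_of_ne this, pderiv_X_of_ne hk]

lemma gl_chart_eval (i₀ : Fin 4) (p : Fin 4 → ℚ) (x : Fin 3 → ℚ) (f : MvPolynomial (Fin 4) ℚ) :
    eval x (glChart i₀ p f) = eval (p + i₀.insertNth (α := fun _ => ℚ) 0 x) f := by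
  induction f using MvPolynomial.induction_on with
  | C a => simp [glChart]
  | add f g hf hg => simp [hf, hg]
  | mul_X f i hf =>
    simp only [map_mul, hf]
    congr 1
    rcases Fin.eq_self_or_eq_succAbove i₀ i with rfl | ⟨k, rfl⟩ <;> simp [glChart]

/-- A homogeneous form whose dehomogenisation has no terms of degree `< m` vanishes to order
`m`. -/
lemma gl_van_of_chart (i₀ : Fin 4) (p : Fin 4 → ℚ) (hp : p i₀ ≠ 0) (m : ℕ) :
    ∀ (d : ℕ) (f : MvPolynomial (Fin 4) ℚ), f.IsHomogeneous d →
      (∀ μ : Fin 3 →₀ ℕ, μ.degree < m → coeff μ (glChart i₀ p f) = 0) →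
      f ∈ vanishingSpace m p := by
  induction m with
  | zero => intro d f _ _; rw [gl_mem_van]; intro ν hν; omega
  | succ m ih =>
    intro d f hf hc
    have hpar : ∀ (j : Fin 3) (μ : Fin 3 →₀ ℕ), μ.degree < m →
        coeff μ (glChart i₀ p (pderiv (i₀.succAbove j) f)) = 0 := by
      intro j μ hμ
      rw [← gl_chart_pderiv, coeff_pderiv, hc _ (by simp [Finsupp.degree_single]; omega), zero_mul]
    apply gl_van_succ
    · have h0 := hc 0 (by simp)
      have h1 := gl_chart_eval i₀ p 0 f
      rw [show p + i₀.insertNth (α := fun _ => ℚ) 0 0 = p from ?_] at h1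
      · rw [← h1, ← constantCoeff_eq] at *
        rw [eval_zero]
        exact h0
      · funext i
        rcases Fin.eq_self_or_eq_succAbove i₀ i with rfl | ⟨k, rfl⟩ <;> simp
    · intro i
      apply ih (d - 1) _ hf.pderiv
      intro μ hμ
      rcases Fin.eq_self_or_eq_succAbove i₀ i with rfl | ⟨k, rfl⟩
      · have e := congrArg (glChart i p) hf.sum_X_mul_pderiv
        rw [Fin.sum_univ_succAbove _ i] at e
        have e2 := congrArg (coeff μ) e
        have hX : ∀ j : Fin 3, coeff μ (glChart i p (X (i.succAbove j) *
            pderiv (i.succAbove j) f)) = 0 := by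
          intro j
          have : glChart i p (X (i.succAbove j)) = C (p (i.succAbove j)) + X j := by
            simp [glChart]
          rw [map_mul, this, add_mul, coeff_add, coeff_C_mul, hpar j μ hμ, coeff_X_mul']
          split_ifs with hj
          · rw [hpar]
            · simp
            · have : (μ - Finsupp.single j 1).degree ≤ μ.degree :=
                Finsupp.degree_mono tsub_le_self
              omega
          · simp
        have h0 : glChart i p (X i) = C (p i) := by simp [glChart]
        rw [map_add, map_sum, coeff_add, coeff_sum, Finset.sum_congr rfl (fun j _ => hX j)] at e2
        simp only [ Finset.sum_const_zero, add_zero,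
          map_mul, h0, coeff_C_mul, map_nsmul, coeff_smul, hc μ (by omega), smul_zero] at e2
        exact (mul_eq_zero.1 e2).resolve_left hp
      · exact hpar k μ hμ

/-! ### Counting monomials and the lower bound -/

/-- Exponents of degree `< m` in three variables. -/
noncomputable def glExps (m : ℕ) : Finset (Fin 3 →₀ ℕ) :=
  (Finset.range m).biUnion fun k => Finset.finsuppAntidiag Finset.univ k

lemma gl_mem_exps (m : ℕ) (μ : Fin 3 →₀ ℕ) : μ ∈ glExps m ↔ μ.degree < m := by
  simp [glExps, Finsupp.degree_eq_sum]

lemma gl_card_exps (m : ℕ) : (glExps m).card ≤ (m + 2).choose 3 := by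
  refine Finset.card_biUnion_le.trans (le_of_eq ?_)
  simp only [Finset.card_finsuppAntidiag_nat_eq_choose]
  induction m with
  | zero => simp
  | succ m ih =>
    rw [Finset.sum_range_succ, ih]
    have h1 : (Finset.univ : Finset (Fin 3)).card + m - 1 = m + 2 := by simp; omega
    have h2 : (m + 2).choose m = (m + 2).choose 2 := by
      rw [← Nat.choose_symm_add]
    rw [h1, h2, show m + 1 + 2 = (m + 2) + 1 by ring, Nat.choose_succ_succ' (m + 2) 2]
    exact Nat.add_comm _ _

lemma gl_finrank_hom (d : ℕ) :
    Module.finrank ℚ (homogeneousSubmodule (Fin 4) ℚ d) = (d + 3).choose 3 := by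
  rw [homogeneousSubmodule_eq_finsupp_supported]
  rw [(AddMonoidAlgebra.supportedEquivFinsupp (R := ℚ) (S := ℚ)
    {e : Fin 4 →₀ ℕ | e.degree = d}).finrank_eq]
  have hS : {e : Fin 4 →₀ ℕ | e.degree = d} =
      ((Finset.finsuppAntidiag Finset.univ d : Finset (Fin 4 →₀ ℕ)) : Set (Fin 4 →₀ ℕ)) := by
    ext e; simp [Finsupp.degree_eq_sum]
  rw [hS]
  rw [Module.finrank_finsupp_self, ← Nat.card_eq_fintype_card, Nat.card_coe_set_eq,
    Set.ncard_coe_finset, Finset.card_finsuppAntidiag_nat_eq_choose]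
  have h1 : (Finset.univ : Finset (Fin 4)).card + d - 1 = d + 3 := by simp; omega
  rw [h1, ← Nat.choose_symm_add]

lemma gl_mem_system (d : ℕ) (ms : List ℕ) (pts : Fin ms.length → Fin 4 → ℚ)
    (f : MvPolynomial (Fin 4) ℚ) :
    f ∈ systemSpace d ms pts ↔
      f.IsHomogeneous d ∧ ∀ i, f ∈ vanishingSpace (ms.get i) (pts i) := by
  simp [systemSpace, Submodule.mem_iInf]

instance glHomFinite (d : ℕ) : Module.Finite ℚ (homogeneousSubmodule (Fin 4) ℚ d) :=
  Module.Finite.iff_fg.2 (homogeneousSubmodule_fg (Fin 4) ℚ d)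

instance glSystemFinite (d : ℕ) (ms : List ℕ) (pts : Fin ms.length → Fin 4 → ℚ) :
    Module.Finite ℚ (systemSpace d ms pts) :=
  Submodule.finiteDimensional_of_le (inf_le_left : systemSpace d ms pts ≤ _)

lemma gl_lower (d : ℕ) (ms : List ℕ) (pts : Fin ms.length → Fin 4 → ℚ)
    (h0 : ∀ i, pts i ≠ 0) :
    max (vdim d ms + 1) 0 ≤ (Module.finrank ℚ (systemSpace d ms pts) : ℤ) := by
  have hex : ∀ i, ∃ k, pts i k ≠ 0 := fun i => by
    by_contra hcon
    push Not at hcon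
    exact h0 i (funext hcon)
  choose k hk using hex
  let W := homogeneousSubmodule (Fin 4) ℚ d
  let Φ : W →ₗ[ℚ] ((x : Σ i : Fin ms.length, glExps (ms.get i)) → ℚ) :=
    LinearMap.pi fun x => (lcoeff ℚ x.2.1) ∘ₗ (glChart (k x.1) (pts x.1)).toLinearMap ∘ₗ W.subtype
  have hker : (LinearMap.ker Φ).map W.subtype ≤ systemSpace d ms pts := by
    rintro _ ⟨f, hf, rfl⟩
    rw [gl_mem_system]
    refine ⟨f.2, fun i => gl_van_of_chart (k i) _ (hk i) _ d _ f.2 fun μ hμ => ?_⟩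
    exact congrFun (LinearMap.mem_ker.1 hf) ⟨i, μ, (gl_mem_exps _ _).2 hμ⟩
  have h1 := Submodule.finrank_mono hker
  rw [Submodule.finrank_map_subtype_eq] at h1
  have h2 := LinearMap.finrank_range_add_finrank_ker Φ
  have h3 := Submodule.finrank_le (LinearMap.range Φ)
  rw [gl_finrank_hom] at h2
  rw [Module.finrank_fintype_fun_eq_card, Fintype.card_sigma] at h3
  have h4 : ∑ i : Fin ms.length, Fintype.card (glExps (ms.get i)) ≤
      ∑ i : Fin ms.length, (ms.get i + 2).choose 3 :=
    Finset.sum_le_sum fun i _ => by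
      rw [Fintype.card_coe]; exact gl_card_exps _
  have h5 : (ms.map fun m => ((m + 2).choose 3 : ℤ)).sum =
      ((∑ i : Fin ms.length, (ms.get i + 2).choose 3 : ℕ) : ℤ) := by
    rw [← Fin.sum_univ_fun_getElem]
    push_cast
    rfl
  rw [vdim, h5]
  apply max_le
  · omega
  · omega

/-! ### Semicontinuity of the kernel dimension -/

lemma gl_semicont {K : Type*} [AddCommGroup K] [Module ℚ K] [Module.Finite ℚ K]
    {ι : Type*} [Finite ι] (Φ : ℚ → (K →ₗ[ℚ] (ι → ℚ)))
    (hc : ∀ w i, Continuous fun t => Φ t w i) :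
    ∀ᶠ t in nhds (0 : ℚ),
      Module.finrank ℚ (LinearMap.ker (Φ t)) ≤ Module.finrank ℚ (LinearMap.ker (Φ 0)) := by
  classical
  have := Fintype.ofFinite ι
  obtain ⟨U, hU⟩ := Submodule.exists_isCompl (LinearMap.ker (Φ 0))
  have hinj : LinearMap.ker ((Φ 0) ∘ₗ U.subtype) = ⊥ := by
    rw [LinearMap.ker_comp, ← Submodule.disjoint_iff_comap_eq_bot]
    exact hU.symm.disjoint
  obtain ⟨ψ, hψ⟩ := LinearMap.exists_leftInverse_of_injective _ hinj
  let b := Module.finBasis ℚ U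
  let M : ℚ → Matrix _ _ ℚ := fun t => LinearMap.toMatrix b b (ψ ∘ₗ (Φ t) ∘ₗ U.subtype)
  have hM : Continuous fun t => (M t).det := by
    apply Continuous.matrix_det
    refine continuous_pi fun i => continuous_pi fun j => ?_
    have : (fun t => M t i j) = fun t => ∑ k, Φ t (b j) k * (b.repr (ψ (Pi.single k 1)) i) := by
      funext t
      simp only [M, LinearMap.toMatrix_apply, LinearMap.comp_apply, Submodule.subtype_apply]
      conv_lhs => rw [← Finset.univ_sum_single (Φ t (b j))]
      simp only [map_sum, Finsupp.coe_finsetSum, Finset.sum_apply]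
      refine Finset.sum_congr rfl fun k _ => ?_
      have : (Pi.single k (Φ t (b j) k) : ι → ℚ) = (Φ t (b j) k) • Pi.single k 1 := by
        rw [← Pi.single_smul]; simp
      rw [this]; simp
    rw [this]
    exact continuous_finsetSum _ fun k _ => (hc _ _).mul continuous_const
  have hM0 : (M 0).det ≠ 0 := by
    simp only [M]
    rw [hψ]
    simp
  filter_upwards [hM.continuousAt.eventually_ne hM0] with t ht
  have hd : Disjoint (LinearMap.ker (Φ t)) U := by
    rw [Submodule.disjoint_def]
    intro x hx hxU
    have h1 : (M t).mulVec (b.repr ⟨x, hxU⟩) = 0 := by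
      simp only [M]
      rw [LinearMap.toMatrix_mulVec_repr]
      simp [LinearMap.mem_ker.1 hx]
    have h2 := Matrix.eq_zero_of_mulVec_eq_zero ht h1
    have h3 : b.repr ⟨x, hxU⟩ = 0 := by ext i; exact congrFun h2 i
    simpa using h3
  have h1 := Submodule.finrank_add_finrank_le_of_disjoint hd
  have h2 := Submodule.finrank_add_eq_of_isCompl hU
  omega

/-! ### Interpolation by the five double points -/

/-- The five points of affine space used in the degeneration. -/
def glPt : Fin 5 → Fin 3 → ℚ := ![![0, 0, 0], ![1, 0, 0], ![0, 1, 0], ![0, 0, 1], ![1, 1, 1]]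

lemma glPt_injective : Function.Injective glPt := by decide

/-- The 1-jets at the five points. -/
noncomputable def glJet : MvPolynomial (Fin 3) ℚ →ₗ[ℚ] (Fin 5 → ℚ) × (Fin 5 → Fin 3 → ℚ) :=
  LinearMap.prod (LinearMap.pi fun a => (aeval (glPt a)).toLinearMap)
    (LinearMap.pi fun a => LinearMap.pi fun j =>
      (aeval (glPt a)).toLinearMap ∘ₗ (pderiv j).toLinearMap)

lemma gl_jet_eq_zero (h : MvPolynomial (Fin 3) ℚ) :
    glJet h = 0 ↔ ∀ a, eval (glPt a) h = 0 ∧ ∀ j, eval (glPt a) (pderiv j h) = 0 := by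
  simp only [glJet, Prod.ext_iff, funext_iff]
  simp [aeval_eq_eval, forall_and]

/-- The exponent `(a, b, e)`. -/
noncomputable def glExp (x : ℕ × ℕ × ℕ) : Fin 3 →₀ ℕ :=
  Finsupp.equivFunOnFinite.symm ![x.1, x.2.1, x.2.2]

lemma gl_exp_surj (μ : Fin 3 →₀ ℕ) : glExp (μ 0, μ 1, μ 2) = μ := by
  ext i; fin_cases i <;> simp [glExp]

lemma gl_exp_inj : Function.Injective glExp := by
  intro x y h
  have h0 := DFunLike.congr_fun h 0
  have h1 := DFunLike.congr_fun h 1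
  have h2 := DFunLike.congr_fun h 2
  simp [glExp] at h0 h1 h2
  exact Prod.ext h0 (Prod.ext h1 h2)

lemma gl_exp_degree (x : ℕ × ℕ × ℕ) : (glExp x).degree = x.1 + x.2.1 + x.2.2 := by
  simp [Finsupp.degree_eq_sum, Fin.sum_univ_three, glExp]

lemma gl_exp_monomial (x : ℕ × ℕ × ℕ) (c : ℚ) :
    monomial (glExp x) c = C c * (X 0 ^ x.1 * X 1 ^ x.2.1 * X 2 ^ x.2.2) := by
  rw [monomial_eq, Finsupp.prod_fintype _ _ (by simp), Fin.prod_univ_three]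
  simp [glExp]

set_option maxHeartbeats 2000000 in
lemma gl_cubic (h : MvPolynomial (Fin 3) ℚ) (hd : h.totalDegree ≤ 3) (hj : glJet h = 0) :
    h = 0 := by
  obtain ⟨c, hc⟩ : ∃ c : ℕ → ℕ → ℕ → ℚ, ∀ a b e, c a b e = coeff (glExp (a, b, e)) h :=
    ⟨_, fun _ _ _ => rfl⟩
  have hz : ∀ a b e, 3 < a + b + e → c a b e = 0 := by
    intro a b e hab
    rw [hc]
    by_contra hne
    have := le_totalDegree (mem_support_iff.2 hne)
    have h2 := gl_exp_degree (a, b, e)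
    rw [Finsupp.degree_apply] at h2
    simp only [Finsupp.sum] at this h2
    omega
  have hexp : h = ∑ x ∈ Finset.range 4 ×ˢ Finset.range 4 ×ˢ Finset.range 4,
      C (c x.1 x.2.1 x.2.2) * (X 0 ^ x.1 * X 1 ^ x.2.1 * X 2 ^ x.2.2) := by
    ext μ
    have : ∀ x : ℕ × ℕ × ℕ, coeff μ (C (c x.1 x.2.1 x.2.2) *
        (X 0 ^ x.1 * X 1 ^ x.2.1 * X 2 ^ x.2.2) : MvPolynomial (Fin 3) ℚ) =
        if x = (μ 0, μ 1, μ 2) then coeff μ h else 0 := by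
      intro x
      rw [← gl_exp_monomial, coeff_monomial]
      by_cases hx : x = (μ 0, μ 1, μ 2)
      · subst hx
        simp [gl_exp_surj, hc]
      · rw [if_neg hx, if_neg]
        intro hh
        exact hx (gl_exp_inj (hh.trans (gl_exp_surj μ).symm))
    simp only [coeff_sum, this, Finset.sum_ite_eq']
    split_ifs with hm
    · rfl
    · rw [← gl_exp_surj μ, ← hc]
      apply hz
      simp at hm
      omega
  rw [gl_jet_eq_zero] at hj
  have hexp2 := hexp
  simp only [Finset.sum_product, Finset.sum_range_succ, Finset.sum_range_zero, zero_add] at hexp2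
  simp only [hz 0 1 3 (by norm_num), hz 0 2 2 (by norm_num), hz 0 2 3 (by norm_num),
    hz 0 3 1 (by norm_num), hz 0 3 2 (by norm_num), hz 0 3 3 (by norm_num),
    hz 1 0 3 (by norm_num), hz 1 1 2 (by norm_num), hz 1 1 3 (by norm_num),
    hz 1 2 1 (by norm_num), hz 1 2 2 (by norm_num), hz 1 2 3 (by norm_num),
    hz 1 3 0 (by norm_num), hz 1 3 1 (by norm_num), hz 1 3 2 (by norm_num),
    hz 1 3 3 (by norm_num), hz 2 0 2 (by norm_num), hz 2 0 3 (by norm_num),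
    hz 2 1 1 (by norm_num), hz 2 1 2 (by norm_num), hz 2 1 3 (by norm_num),
    hz 2 2 0 (by norm_num), hz 2 2 1 (by norm_num), hz 2 2 2 (by norm_num),
    hz 2 2 3 (by norm_num), hz 2 3 0 (by norm_num), hz 2 3 1 (by norm_num),
    hz 2 3 2 (by norm_num), hz 2 3 3 (by norm_num), hz 3 0 1 (by norm_num),
    hz 3 0 2 (by norm_num), hz 3 0 3 (by norm_num), hz 3 1 0 (by norm_num),
    hz 3 1 1 (by norm_num), hz 3 1 2 (by norm_num), hz 3 1 3 (by norm_num),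
    hz 3 2 0 (by norm_num), hz 3 2 1 (by norm_num), hz 3 2 2 (by norm_num),
    hz 3 2 3 (by norm_num), hz 3 3 0 (by norm_num), hz 3 3 1 (by norm_num),
    hz 3 3 2 (by norm_num), hz 3 3 3 (by norm_num),
    C_0, zero_mul, add_zero, pow_zero, mul_one, one_mul, pow_one] at hexp2
  have p01 : (pderiv (0 : Fin 3)) (X 1 : MvPolynomial (Fin 3) ℚ) = 0 := pderiv_X_of_ne (by decide)
  have p02 : (pderiv (0 : Fin 3)) (X 2 : MvPolynomial (Fin 3) ℚ) = 0 := pderiv_X_of_ne (by decide)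
  have p10 : (pderiv (1 : Fin 3)) (X 0 : MvPolynomial (Fin 3) ℚ) = 0 := pderiv_X_of_ne (by decide)
  have p12 : (pderiv (1 : Fin 3)) (X 2 : MvPolynomial (Fin 3) ℚ) = 0 := pderiv_X_of_ne (by decide)
  have p20 : (pderiv (2 : Fin 3)) (X 0 : MvPolynomial (Fin 3) ℚ) = 0 := pderiv_X_of_ne (by decide)
  have p21 : (pderiv (2 : Fin 3)) (X 1 : MvPolynomial (Fin 3) ℚ) = 0 := pderiv_X_of_ne (by decide)
  have q0 := hj 0
  have q1 := hj 1
  have q2 := hj 2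
  have q3 := hj 3
  have q4 := hj 4
  rw [hexp2] at q0 q1 q2 q3 q4
  simp only [glPt, Fin.forall_fin_succ, Fin.isValue, Matrix.cons_val, Fin.succ_zero_eq_one,
    Fin.succ_one_eq_two, IsEmpty.forall_iff, and_true] at q0 q1 q2 q3 q4
  simp only [map_add, pderiv_mul, pderiv_pow, pderiv_C, pderiv_X_self, p01, p02, p10, p12,
    p20, p21, map_mul, map_pow, eval_C, eval_X, Matrix.cons_val, map_zero, map_one,
    map_natCast] at q0 q1 q2 q3 q4
  norm_num at q0 q1 q2 q3 q4
  obtain ⟨z000, z100, z010, z001⟩ := q0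
  simp only [z000, z100, z010, z001, zero_add, add_zero] at q1 q2 q3 q4
  obtain ⟨a1, a2, a3, a4⟩ := q1
  obtain ⟨b1, b2, b3, b4⟩ := q2
  obtain ⟨d1, d2, d3, d4⟩ := q3
  obtain ⟨f1, f2, f3, f4⟩ := q4
  have z200 : c 2 0 0 = 0 := by linarith
  have z300 : c 3 0 0 = 0 := by linarith
  have z020 : c 0 2 0 = 0 := by linarith
  have z030 : c 0 3 0 = 0 := by linarith
  have z002 : c 0 0 2 = 0 := by linarith
  have z003 : c 0 0 3 = 0 := by linarith
  simp only [z200, z300, z020, z030, z002, z003, zero_add, add_zero, zero_mul] at *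
  have z111 : c 1 1 1 = 0 := by linarith
  have z110 : c 1 1 0 = 0 := by linarith
  have z101 : c 1 0 1 = 0 := by linarith
  have z011 : c 0 1 1 = 0 := by linarith
  have z210 : c 2 1 0 = 0 := by linarith
  have z201 : c 2 0 1 = 0 := by linarith
  have z120 : c 1 2 0 = 0 := by linarith
  have z021 : c 0 2 1 = 0 := by linarith
  have z102 : c 1 0 2 = 0 := by linarith
  have z012 : c 0 1 2 = 0 := by linarith
  rw [hexp2]
  simp [z000, z100, z010, z001, z111, z110, z101, z011, z210, z201, z120, z021, z102, z012]

lemma gl_exists_dual : ∃ lam : (Fin 3 →₀ ℕ) → (MvPolynomial (Fin 3) ℚ →ₗ[ℚ] ℚ),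
    (∀ ν h, glJet h = 0 → lam ν h = 0) ∧
    ∀ ν μ : Fin 3 →₀ ℕ, μ.degree < 4 →
      lam ν (monomial μ 1) = if μ = ν then 1 else 0 := by
  classical
  let E := restrictTotalDegree (Fin 3) ℚ 3
  have hinj : LinearMap.ker (glJet ∘ₗ E.subtype) = ⊥ := by
    rw [LinearMap.ker_eq_bot']
    intro h hh
    exact Subtype.ext (gl_cubic h.1 ((mem_restrictTotalDegree _ _ _).1 h.2) hh)
  obtain ⟨L, hL⟩ := LinearMap.exists_leftInverse_of_injective _ hinj
  refine ⟨fun ν => lcoeff ℚ ν ∘ₗ E.subtype ∘ₗ L ∘ₗ glJet, fun ν h hh => by simp [hh], ?_⟩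
  intro ν μ hμ
  have hE : (monomial μ (1 : ℚ)) ∈ E := by
    rw [mem_restrictTotalDegree]
    refine (totalDegree_monomial_le _ _).trans ?_
    rw [Finsupp.degree_apply] at hμ
    simp only [Finsupp.sum, id]
    omega
  have h1 := DFunLike.congr_fun hL ⟨_, hE⟩
  simp only [LinearMap.comp_apply, Submodule.subtype_apply, LinearMap.id_apply] at h1
  simp only [LinearMap.comp_apply, h1, Submodule.subtype_apply, lcoeff_apply, coeff_monomial]

/-- The dilation `x ↦ t x`. -/
noncomputable def glScale (t : ℚ) : MvPolynomial (Fin 3) ℚ →ₐ[ℚ] MvPolynomial (Fin 3) ℚ :=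
  aeval fun j => C t * X j

lemma gl_scale_eval (t : ℚ) (a : Fin 3 → ℚ) (h : MvPolynomial (Fin 3) ℚ) :
    eval a (glScale t h) = eval (t • a) h := by
  induction h using MvPolynomial.induction_on with
  | C a => simp [glScale]
  | add f g hf hg => simp [hf, hg]
  | mul_X f i hf => simp only [map_mul, hf]; simp [glScale]

lemma gl_scale_pderiv (t : ℚ) (j : Fin 3) (h : MvPolynomial (Fin 3) ℚ) :
    pderiv j (glScale t h) = C t * glScale t (pderiv j h) := by
  induction h using MvPolynomial.induction_on with
  | C a => simp [glScale]
  | add f g hf hg => simp [hf, hg, mul_add]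
  | mul_X f i hf =>
    have hX : glScale t (X i) = C t * X i := by simp [glScale]
    simp only [map_mul, pderiv_mul, hf, hX, map_add, pderiv_C]
    by_cases hk : i = j
    · subst hk; simp; ring
    · simp [pderiv_X_of_ne hk]; ring

lemma gl_scale_monomial (t : ℚ) (μ : Fin 3 →₀ ℕ) :
    glScale t (monomial μ 1) = t ^ μ.degree • monomial μ 1 := by
  rw [monomial_eq, glScale]
  simp only [map_one, one_mul, Finsupp.prod_fintype, pow_zero, implies_true, map_prod, map_pow,
    aeval_X, mul_pow, Finset.prod_mul_distrib, Finset.prod_pow_eq_pow_sum, Finsupp.degree_eq_sum]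
  rw [← map_pow, ← smul_eq_C_mul]

/-- The rescaled conditions: they converge to the coefficient functionals as `t → 0`. -/
noncomputable def glPhi (lam : (Fin 3 →₀ ℕ) → (MvPolynomial (Fin 3) ℚ →ₗ[ℚ] ℚ)) (t : ℚ)
    (ν : Fin 3 →₀ ℕ) : MvPolynomial (Fin 3) ℚ →ₗ[ℚ] ℚ :=
  (basisMonomials (Fin 3) ℚ).constr ℚ
    fun μ => t ^ (μ.degree - ν.degree) * lam ν (monomial μ 1)

lemma gl_phi_monomial (lam : (Fin 3 →₀ ℕ) → (MvPolynomial (Fin 3) ℚ →ₗ[ℚ] ℚ)) (t : ℚ)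
    (ν μ : Fin 3 →₀ ℕ) :
    glPhi lam t ν (monomial μ 1) = t ^ (μ.degree - ν.degree) * lam ν (monomial μ 1) := by
  have := (basisMonomials (Fin 3) ℚ).constr_basis ℚ
    (fun μ => t ^ (μ.degree - ν.degree) * lam ν (monomial μ 1)) μ
  rwa [coe_basisMonomials] at this

lemma gl_phi_cont (lam : (Fin 3 →₀ ℕ) → (MvPolynomial (Fin 3) ℚ →ₗ[ℚ] ℚ))
    (ν : Fin 3 →₀ ℕ) (h : MvPolynomial (Fin 3) ℚ) : Continuous fun t => glPhi lam t ν h := by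
  induction h using MvPolynomial.induction_on' with
  | monomial μ c =>
    have : (monomial μ c : MvPolynomial (Fin 3) ℚ) = c • monomial μ 1 := by
      rw [smul_monomial]; simp
    simp only [this, map_smul, gl_phi_monomial]
    fun_prop
  | add f g hf hg => simp only [map_add]; exact hf.add hg

lemma gl_phi_zero (lam : (Fin 3 →₀ ℕ) → (MvPolynomial (Fin 3) ℚ →ₗ[ℚ] ℚ))
    (hlam : ∀ ν μ : Fin 3 →₀ ℕ, μ.degree < 4 →
      lam ν (monomial μ 1) = if μ = ν then 1 else 0)
    (ν : Fin 3 →₀ ℕ) (hν : ν.degree < 4) (h : MvPolynomial (Fin 3) ℚ) :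
    glPhi lam 0 ν h = coeff ν h := by
  have : glPhi lam 0 ν = lcoeff ℚ ν := by
    apply (basisMonomials (Fin 3) ℚ).ext
    intro μ
    rw [coe_basisMonomials]
    simp only [gl_phi_monomial, lcoeff_apply, coeff_monomial]
    by_cases hμ : μ.degree ≤ ν.degree
    · rw [hlam _ _ (by omega), Nat.sub_eq_zero_of_le hμ]
      simp
    · rw [zero_pow (by omega), if_neg, zero_mul]
      rintro rfl
      exact hμ le_rfl
  rw [this]; rfl

lemma gl_phi_scale (lam : (Fin 3 →₀ ℕ) → (MvPolynomial (Fin 3) ℚ →ₗ[ℚ] ℚ))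
    (hlam : ∀ ν μ : Fin 3 →₀ ℕ, μ.degree < 4 →
      lam ν (monomial μ 1) = if μ = ν then 1 else 0)
    (t : ℚ) (ν : Fin 3 →₀ ℕ) (hν : ν.degree < 4) (h : MvPolynomial (Fin 3) ℚ) :
    t ^ ν.degree * glPhi lam t ν h = lam ν (glScale t h) := by
  have : t ^ ν.degree • glPhi lam t ν = lam ν ∘ₗ (glScale t).toLinearMap := by
    apply (basisMonomials (Fin 3) ℚ).ext
    intro μ
    rw [coe_basisMonomials]
    simp only [LinearMap.smul_apply, LinearMap.comp_apply, AlgHom.toLinearMap_apply,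
      gl_phi_monomial, gl_scale_monomial, map_smul, smul_eq_mul]
    by_cases hμ : ν.degree ≤ μ.degree
    · rw [← mul_assoc, ← pow_add, Nat.add_sub_cancel' hμ]
    · rw [hlam _ _ (by omega), if_neg]
      · simp
      · rintro rfl
        exact hμ le_rfl
  have h2 := DFunLike.congr_fun this h
  simpa using h2

/-! ### Linear independence of pairs -/

lemma gl_indep_iff (u v : Fin 4 → ℚ) :
    LinearIndependent ℚ ![u, v] ↔ ∃ i j, u i * v j - u j * v i ≠ 0 := by
  rw [LinearIndependent.pair_iff]
  constructor
  · intro h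
    by_contra hcon
    push Not at hcon
    have hu : ∀ i, u i = 0 := by
      intro i
      have := (h (v i) (-u i) (by
        funext j
        have := hcon i j
        simp
        linarith)).2
      linarith
    have := (h 1 0 (by funext j; simp [hu])).1
    norm_num at this
  · rintro ⟨i, j, hij⟩ s t hst
    have hi := congrFun hst i
    have hj := congrFun hst j
    simp at hi hj
    constructor
    · have : s * (u i * v j - u j * v i) = 0 := by linear_combination v j * hi - v i * hj
      exact (mul_eq_zero.1 this).resolve_right hij
    · have : t * (u i * v j - u j * v i) = 0 := by linear_combination u i * hj - u j * hi
      exact (mul_eq_zero.1 this).resolve_right hij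

/-- The moving points. -/
def glMove (i₀ : Fin 4) (p : Fin 4 → ℚ) (t : ℚ) (a : Fin 5) : Fin 4 → ℚ :=
  p + i₀.insertNth (α := fun _ => ℚ) 0 (t • glPt a)

lemma gl_move_self (i₀ : Fin 4) (p : Fin 4 → ℚ) (t : ℚ) (a : Fin 5) :
    glMove i₀ p t a i₀ = p i₀ := by simp [glMove]

lemma gl_move_cont (i₀ : Fin 4) (p : Fin 4 → ℚ) (a : Fin 5) (i : Fin 4) :
    Continuous fun t => glMove i₀ p t a i := by
  rcases Fin.eq_self_or_eq_succAbove i₀ i with rfl | ⟨k, rfl⟩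
  · simp only [gl_move_self]; exact continuous_const
  · simp only [glMove, Pi.add_apply, Fin.insertNth_apply_succAbove, Pi.smul_apply, smul_eq_mul]
    fun_prop

lemma gl_move_zero (i₀ : Fin 4) (p : Fin 4 → ℚ) (a : Fin 5) : glMove i₀ p 0 a = p := by
  funext i
  rcases Fin.eq_self_or_eq_succAbove i₀ i with rfl | ⟨k, rfl⟩ <;> simp [glMove]

lemma gl_move_indep (i₀ : Fin 4) (p : Fin 4 → ℚ) (hp : p i₀ ≠ 0) (t : ℚ) (ht : t ≠ 0)
    (a b : Fin 5) (hab : a ≠ b) :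
    LinearIndependent ℚ ![glMove i₀ p t a, glMove i₀ p t b] := by
  rw [gl_indep_iff]
  obtain ⟨k, hk⟩ : ∃ k, glPt a k ≠ glPt b k := by
    by_contra hcon
    push Not at hcon
    exact hab (glPt_injective (funext hcon))
  refine ⟨i₀, i₀.succAbove k, ?_⟩
  have : glMove i₀ p t a i₀ * glMove i₀ p t b (i₀.succAbove k) -
      glMove i₀ p t a (i₀.succAbove k) * glMove i₀ p t b i₀ =
      p i₀ * t * (glPt b k - glPt a k) := by
    simp [glMove]; ring
  rw [this]
  exact mul_ne_zero (mul_ne_zero hp ht) (sub_ne_zero.2 hk.symm)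

lemma gl_move_eventually (i₀ : Fin 4) (p q : Fin 4 → ℚ) (a : Fin 5)
    (h : LinearIndependent ℚ ![q, p]) :
    ∀ᶠ t in nhds (0 : ℚ), LinearIndependent ℚ ![q, glMove i₀ p t a] := by
  simp only [gl_indep_iff] at h ⊢
  obtain ⟨i, j, hij⟩ := h
  have hc : Continuous fun t => q i * glMove i₀ p t a j - q j * glMove i₀ p t a i :=
    (continuous_const.mul (gl_move_cont i₀ p a j)).sub
      (continuous_const.mul (gl_move_cont i₀ p a i))
  have := hc.continuousAt (x := 0) |>.eventually_ne (y := 0) (by simpa [gl_move_zero] using hij)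
  filter_upwards [this] with t ht
  exact ⟨i, j, ht⟩

/-- If `f` is singular at the five moving points then the rescaled conditions vanish. -/
lemma gl_phi_of_van (lam : (Fin 3 →₀ ℕ) → (MvPolynomial (Fin 3) ℚ →ₗ[ℚ] ℚ))
    (hjet : ∀ ν h, glJet h = 0 → lam ν h = 0)
    (hlam : ∀ ν μ : Fin 3 →₀ ℕ, μ.degree < 4 →
      lam ν (monomial μ 1) = if μ = ν then 1 else 0)
    (i₀ : Fin 4) (p : Fin 4 → ℚ) (t : ℚ) (ht : t ≠ 0) (f : MvPolynomial (Fin 4) ℚ)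
    (hf : ∀ a, f ∈ vanishingSpace 2 (glMove i₀ p t a)) (ν : Fin 3 →₀ ℕ) (hν : ν.degree < 4) :
    glPhi lam t ν (glChart i₀ p f) = 0 := by
  have h1 := gl_phi_scale lam hlam t ν hν (glChart i₀ p f)
  rw [hjet ν] at h1
  · exact (mul_eq_zero.1 h1).resolve_left (pow_ne_zero _ ht)
  · rw [gl_jet_eq_zero]
    intro a
    obtain ⟨h2, h3⟩ := gl_van_two _ _ (hf a)
    refine ⟨?_, fun j => ?_⟩
    · rw [gl_scale_eval, gl_chart_eval]; exact h2
    · rw [gl_scale_pderiv, map_mul, gl_scale_eval, gl_chart_pderiv, gl_chart_eval]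
      have := h3 (i₀.succAbove j)
      rw [glMove] at this
      rw [this, mul_zero]

/-! ### The main theorem -/

lemma gl_vdim_eq (d : ℕ) (ms : List ℕ) :
    vdim d (ms ++ List.replicate 5 2) = vdim d (ms ++ [4]) := by
  simp [vdim, List.replicate, Nat.choose]

/-- Glueing `2^{×5} → 4`: non-specialty of `L_3(d; m_1,…,m_r, 4)` implies non-specialty
of `L_3(d; m_1,…,m_r, 2^{×5})`. -/
theorem glueing_two_pow_five_to_four (d : ℕ) (ms : List ℕ)
    (h : nonSpecial d (ms ++ [4])) :
    nonSpecial d (ms ++ List.replicate 5 2) := by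
  obtain ⟨pts, hne, hind, hdim⟩ := h
  have hlen : (ms ++ [4]).length = ms.length + 1 := by simp
  have hlen2 : (ms ++ List.replicate 5 2).length = ms.length + 5 := by simp
  let old : Fin ms.length → Fin 4 → ℚ := fun i => pts ⟨i, by omega⟩
  let p : Fin 4 → ℚ := pts ⟨ms.length, by omega⟩
  obtain ⟨i₀, hp⟩ : ∃ k, p k ≠ 0 := by
    by_contra hcon
    push Not at hcon
    exact hne _ (funext hcon)
  obtain ⟨lam, hjet, hlam⟩ := gl_exists_dual
  let K := systemSpace d ms old
  let Φ : ℚ → (K →ₗ[ℚ] (glExps 4 → ℚ)) := fun t =>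
    LinearMap.pi fun ν => glPhi lam t ν.1 ∘ₗ (glChart i₀ p).toLinearMap ∘ₗ K.subtype
  have hsemi := gl_semicont Φ (fun w ν => gl_phi_cont lam ν.1 _)
  have hev : ∀ᶠ t in nhds (0 : ℚ), ∀ (i : Fin ms.length) (a : Fin 5),
      LinearIndependent ℚ ![old i, glMove i₀ p t a] := by
    rw [Filter.eventually_all]
    intro i
    rw [Filter.eventually_all]
    intro a
    apply gl_move_eventually
    apply hind
    intro hh
    have := congrArg Fin.val hh
    have := i.2
    simp at *
    omega
  have hne0 : ∀ᶠ t in nhdsWithin (0 : ℚ) {0}ᶜ, t ≠ 0 := eventually_mem_nhdsWithin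
  obtain ⟨t, ⟨ht1, ht2⟩, ht0⟩ :=
    (((hsemi.and hev).filter_mono nhdsWithin_le_nhds).and hne0).exists
  let new : Fin (ms ++ List.replicate 5 2).length → Fin 4 → ℚ := fun i =>
    if hi : i.1 < ms.length then old ⟨i, hi⟩ else glMove i₀ p t ⟨i - ms.length, by omega⟩
  have hmove : ∀ a, glMove i₀ p t a ≠ 0 := fun a h0 => hp (by
    rw [← gl_move_self i₀ p t a, h0]; rfl)
  have hnew0 : ∀ i, new i ≠ 0 := by
    intro i
    simp only [new]
    split_ifs with hi
    · exact hne _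
    · exact hmove _
  refine ⟨new, hnew0, ?_, ?_⟩
  · intro i j hij
    have hij' : i.1 ≠ j.1 := fun h => hij (Fin.ext h)
    simp only [new]
    split_ifs with hi hj hj
    · apply hind
      intro hh
      exact hij' (by simpa using congrArg Fin.val hh)
    · exact ht2 _ _
    · have := ht2 ⟨j, hj⟩ ⟨i - ms.length, by omega⟩
      exact LinearIndependent.pair_symm_iff.1 this
    · apply gl_move_indep i₀ p hp t ht0
      intro hh
      have := congrArg Fin.val hh
      simp at this
      omega
  · refine le_antisymm ?_ (gl_lower d _ new hnew0)
    rw [gl_vdim_eq, ← hdim]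
    have hA : systemSpace d (ms ++ List.replicate 5 2) new ≤
        (LinearMap.ker (Φ t)).map K.subtype := by
      intro f hf
      rw [gl_mem_system] at hf
      have hK : f ∈ K := by
        rw [gl_mem_system]
        refine ⟨hf.1, fun i => ?_⟩
        have := hf.2 ⟨i, by omega⟩
        simpa [new, List.getElem_append_left] using this
      refine ⟨⟨f, hK⟩, ?_, rfl⟩
      rw [SetLike.mem_coe, LinearMap.mem_ker]
      funext ν
      refine gl_phi_of_van lam hjet hlam i₀ p t ht0 f (fun a => ?_) ν.1 ((gl_mem_exps _ _).1 ν.2)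
      have := hf.2 ⟨ms.length + a, by omega⟩
      have hget : (ms ++ List.replicate 5 2).get ⟨ms.length + a, by omega⟩ = 2 := by
        rw [List.get_eq_getElem, List.getElem_append_right (by simp)]
        exact List.getElem_replicate _
      rw [hget] at this
      simpa [new] using this
    have hB : (LinearMap.ker (Φ 0)).map K.subtype ≤ systemSpace d (ms ++ [4]) pts := by
      rintro _ ⟨f, hf, rfl⟩
      have hfK := (gl_mem_system _ _ _ _).1 f.2
      rw [gl_mem_system]
      refine ⟨hfK.1, fun i => ?_⟩
      by_cases hi : i.1 < ms.length
      · have := hfK.2 ⟨i, hi⟩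
        simpa [old, List.getElem_append_left hi] using this
      · have hi' : i = ⟨ms.length, by simp⟩ := Fin.ext (by have := i.2; simp; omega)
        rw [hi']
        have : f.1 ∈ vanishingSpace 4 p := by
          apply gl_van_of_chart i₀ p hp 4 d _ hfK.1
          intro μ hμ
          have h1 := congrFun (LinearMap.mem_ker.1 hf) ⟨μ, (gl_mem_exps _ _).2 hμ⟩
          rw [← gl_phi_zero lam hlam μ hμ]
          exact h1
        simpa using this
    have h1 := Submodule.finrank_mono hA
    have h2 := Submodule.finrank_mono hB
    rw [Submodule.finrank_map_subtype_eq] at h1 h2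
    exact_mod_cast h1.trans (ht1.trans h2)
end
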